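/- There exists a constant C > 0 such that for every integer n > 1 and every C² real-valued function φ on the Riemann sphere ℙ¹, |(d−1)·Σ_{λ∈ℂ : Φ_n(λ,0)=0} φ(λ) − ν(n)·⟨T_f, φ⟩| ≤ (sup_{ℙ¹} |ddᶜφ/ω|)·((2 log d)·σ₁(n) + C·σ₀(n)), where the sum is over the zeros of the polynomial λ ↦ Φ_n(λ,0) counted with multiplicity. -/

import Mathlib

open MeasureTheory Real Polynomial

/- STATEMENT 18:
There exists a constant C > 0 such that for every n > 1 and every C² real-valued function
φ on ℙ¹,
|(d−1)·Σ_{λ∈ℂ : Φ_n(λ,0)=0} φ(λ) − ν(n)·⟨T_f, φ⟩|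
  ≤ (sup_{ℙ¹}|ddᶜφ/ω|)·((2 log d)·σ₁(n) + C·σ₀(n)),
the sum being over the zeros of λ ↦ Φ_n(λ,0) counted with multiplicity, where
⟨T_f, φ⟩ := ((d−1)/d)·(φ(∞) + ∫_ℂ g_I(λ)·(2π)^{−1}·Δφ(λ) dA(λ)) and ddᶜφ/ω equals
(1+|λ|²)²·Δφ(λ)/2 on ℂ. The dynatomic polynomial Φ_n ∈ ℤ[λ,z] is encoded as Φ : (ℂ[λ])[z]
satisfying the defining product identity and monicity; λ ↦ Φ_n(λ,0) is Φ.coeff 0.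
A C² function φ on ℙ¹ is encoded by φ : ℂ → ℝ (C² on ℂ), its value φ∞ at ∞, and the
requirement that w ↦ φ(1/w) (extended by φ∞ at 0) is C² at 0; the sup of |ddᶜφ/ω| over ℙ¹
is encoded by an arbitrary pointwise bound K on ℂ. -/

noncomputable def fc (d : ℕ) (lam z : ℂ) : ℂ := z ^ d + lam

noncomputable def nu (d n : ℕ) : ℤ :=
  ∑ m ∈ n.divisors, ArithmeticFunction.moebius (n / m) * (d : ℤ) ^ m

/-- The Laplacian Δφ = ∂²φ/∂x² + ∂²φ/∂y² of a function `φ : ℂ → ℝ`. -/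
noncomputable def lap (φ : ℂ → ℝ) (z : ℂ) : ℝ :=
  iteratedFDeriv ℝ 2 φ z ![1, 1] + iteratedFDeriv ℝ 2 φ z ![Complex.I, Complex.I]

/-- The critical orbit. -/
noncomputable def cc (d : ℕ) (lam : ℂ) : ℕ → ℂ
  | 0 => 0
  | k + 1 => (cc d lam k) ^ d + lam

lemma cc_succ (d : ℕ) (lam : ℂ) (k : ℕ) : cc d lam (k + 1) = (cc d lam k) ^ d + lam := rfl

lemma cc_zero (d : ℕ) (lam : ℂ) : cc d lam 0 = 0 := rfl

lemma cc_one {d : ℕ} (hd : 1 < d) (lam : ℂ) : cc d lam 1 = lam := by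
  rw [cc_succ, cc_zero, zero_pow (by omega), zero_add]

lemma iter_eq (d : ℕ) (lam : ℂ) (k : ℕ) : (fc d lam)^[k] 0 = cc d lam k := by
  induction k with
  | zero => rfl
  | succ k ih => rw [Function.iterate_succ_apply', ih]; rfl

/-- The critical orbit polynomials. -/
noncomputable def Fp (d : ℕ) : ℕ → ℂ[X]
  | 0 => 0
  | k + 1 => (Fp d k) ^ d + X

lemma Fp_eval (d : ℕ) (lam : ℂ) (k : ℕ) : (Fp d k).eval lam = cc d lam k := by
  induction k with
  | zero => simp [Fp, cc]
  | succ k ih => simp [Fp, cc, ih]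

lemma Fp_one {d : ℕ} (hd : 1 < d) : Fp d 1 = X := by
  simp [Fp, show d ≠ 0 by omega]

lemma Fp_monic_deg {d : ℕ} (hd : 1 < d) (k : ℕ) :
    (Fp d (k + 1)).Monic ∧ (Fp d (k + 1)).natDegree = d ^ k := by
  induction k with
  | zero => rw [Fp_one hd]; simp [monic_X]
  | succ k ih =>
    have hm : ((Fp d (k + 1)) ^ d).Monic := ih.1.pow d
    have hdeg : ((Fp d (k + 1)) ^ d).natDegree = d ^ (k + 1) := by
      rw [ih.1.natDegree_pow, ih.2]; ring
    have hlt : natDegree (X : ℂ[X]) < ((Fp d (k + 1)) ^ d).natDegree := by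
      rw [hdeg, natDegree_X]; exact Nat.one_lt_pow (by omega) hd
    have hlt' : degree (X : ℂ[X]) < ((Fp d (k + 1)) ^ d).degree := degree_lt_degree hlt
    change (((Fp d (k + 1)) ^ d) + X).Monic ∧ (((Fp d (k + 1)) ^ d) + X).natDegree = _
    exact ⟨hm.add_of_left hlt', by rw [natDegree_add_eq_left_of_natDegree_lt hlt, hdeg]⟩

lemma Fp_ne_zero {d : ℕ} (hd : 1 < d) {k : ℕ} (hk : 1 ≤ k) : Fp d k ≠ 0 := by
  obtain ⟨j, rfl⟩ := Nat.exists_eq_add_of_le' hk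
  exact (Fp_monic_deg hd j).1.ne_zero

lemma Fp_card_roots {d : ℕ} (hd : 1 < d) {k : ℕ} (hk : 1 ≤ k) :
    (Fp d k).roots.card = d ^ (k - 1) := by
  obtain ⟨j, rfl⟩ := Nat.exists_eq_add_of_le' hk
  rw [← (Fp_monic_deg hd j).2.trans (by simp : d ^ j = d ^ (j + 1 - 1))]
  exact (IsAlgClosed.splits _).natDegree_eq_card_roots.symm

/-- The error function. -/
noncomputable def kap (lam : ℂ) : ℝ := Real.log 2 + log⁺ ‖lam‖

lemma kap_nonneg (lam : ℂ) : 0 ≤ kap lam :=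
  add_nonneg (Real.log_nonneg (by norm_num)) posLog_nonneg

lemma ell_step (d : ℕ) (lam : ℂ) (k : ℕ) :
    |log⁺ ‖cc d lam (k + 1)‖ - d * log⁺ ‖cc d lam k‖| ≤ kap lam := by
  have h1 : log⁺ ‖cc d lam k ^ d‖ = d * log⁺ ‖cc d lam k‖ := by
    rw [norm_pow, Real.posLog_pow]
  have h2 := posLog_norm_add_le (cc d lam k ^ d) lam
  have h3 := posLog_norm_add_le (cc d lam (k + 1)) (-lam)
  rw [cc_succ, add_neg_cancel_right, norm_neg] at h3
  rw [← h1, cc_succ, kap, abs_le]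
  constructor <;> linarith

lemma half_log_bound {x : ℝ} (hx : 0 ≤ x) :
    |(1 / 2) * Real.log (1 + x ^ 2) - log⁺ x| ≤ Real.log 2 := by
  have h2 : 0 < Real.log 2 := Real.log_pos (by norm_num)
  rcases le_total x 1 with h | h
  · have : log⁺ x = 0 := by rw [posLog_eq_zero_iff, abs_of_nonneg hx]; exact h
    rw [this, sub_zero, abs_of_nonneg]
    · have : Real.log (1 + x ^ 2) ≤ Real.log 2 := Real.log_le_log (by positivity) (by nlinarith)
      linarith
    · have := Real.log_nonneg (show 1 ≤ 1 + x ^ 2 by nlinarith)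
      positivity
  · have : log⁺ x = Real.log x := posLog_eq_log (by rw [abs_of_nonneg hx]; exact h)
    have h3 : Real.log x = (1/2) * Real.log (x ^ 2) := by rw [Real.log_pow]; push_cast; ring
    have h4 : Real.log (x ^ 2) ≤ Real.log (1 + x ^ 2) :=
      Real.log_le_log (by positivity) (by linarith)
    have h5 : Real.log (1 + x ^ 2) ≤ Real.log 2 + Real.log (x ^ 2) := by
      rw [← Real.log_mul (by norm_num) (by positivity)]
      exact Real.log_le_log (by positivity) (by nlinarith)
    rw [this, h3, abs_le]; constructor <;> linarith

lemma ell_tel {d : ℕ} (hd : 1 < d) (lam : ℂ) (m j : ℕ) :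
    |log⁺ ‖cc d lam (m + 1 + j)‖ / (d : ℝ) ^ (m + j) - log⁺ ‖cc d lam (m + 1)‖ / (d : ℝ) ^ m|
      ≤ kap lam * (1 / (d : ℝ) ^ m - 1 / (d : ℝ) ^ (m + j)) := by
  have hd0 : (0 : ℝ) < d := by positivity
  have hd2 : (2 : ℝ) ≤ d := by exact_mod_cast hd
  induction j with
  | zero => simp
  | succ j ih =>
    have h1 := ell_step d lam (m + 1 + j)
    have hpos : (0 : ℝ) < (d : ℝ) ^ (m + j + 1) := by positivity
    have h2 : |log⁺ ‖cc d lam (m + 1 + (j + 1))‖ / (d : ℝ) ^ (m + (j + 1))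
        - log⁺ ‖cc d lam (m + 1 + j)‖ / (d : ℝ) ^ (m + j)| ≤ kap lam / (d : ℝ) ^ (m + j + 1) := by
      have : log⁺ ‖cc d lam (m + 1 + (j + 1))‖ / (d : ℝ) ^ (m + (j + 1))
        - log⁺ ‖cc d lam (m + 1 + j)‖ / (d : ℝ) ^ (m + j) =
        (log⁺ ‖cc d lam (m + 1 + j + 1)‖ - d * log⁺ ‖cc d lam (m + 1 + j)‖)
          / (d : ℝ) ^ (m + j + 1) := by
        rw [pow_succ, show m + (j + 1) = m + j + 1 from rfl, pow_succ,
          show m + 1 + (j + 1) = m + 1 + j + 1 from rfl]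
        field_simp
      rw [this, abs_div, abs_of_pos hpos]
      gcongr
    have h3 : kap lam / (d : ℝ) ^ (m + j + 1) ≤
        kap lam * (1 / (d : ℝ) ^ (m + j) - 1 / (d : ℝ) ^ (m + (j + 1))) := by
      have : (1 / (d : ℝ) ^ (m + j) - 1 / (d : ℝ) ^ (m + (j + 1))) =
          (d - 1) / (d : ℝ) ^ (m + j + 1) := by
        rw [show m + (j + 1) = m + j + 1 from rfl, pow_succ]; field_simp
      rw [this, mul_div_assoc']
      have := kap_nonneg lam
      gcongr
      nlinarith
    calc _ ≤ _ := abs_sub_le _ (log⁺ ‖cc d lam (m + 1 + j)‖ / (d : ℝ) ^ (m + j)) _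
      _ ≤ _ := add_le_add (h2.trans h3) ih
      _ = _ := by ring

lemma gI_bound {d : ℕ} (hd : 1 < d) (gI : ℂ → ℝ)
    (hgI : ∀ lam : ℂ, Filter.Tendsto
      (fun k : ℕ => (1 / 2) * Real.log (1 + ‖(fc d lam)^[k] 0‖ ^ 2) / (d : ℝ) ^ (k - 1))
      Filter.atTop (nhds (gI lam))) (lam : ℂ) (m : ℕ) (hm : 1 ≤ m) :
    |(d : ℝ) ^ (m - 1) * gI lam - log⁺ ‖cc d lam m‖| ≤ kap lam := by
  obtain ⟨m, rfl⟩ := Nat.exists_eq_add_of_le' hm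
  have hd0 : (0 : ℝ) < d := by positivity
  have hd2 : (1 : ℝ) < d := by exact_mod_cast hd
  have ht : Filter.Tendsto (fun j : ℕ => (1 / 2) * Real.log (1 + ‖cc d lam (m + 1 + j)‖ ^ 2)
      / (d : ℝ) ^ (m + j)) Filter.atTop (nhds (gI lam)) := by
    have := (hgI lam).comp (Filter.tendsto_add_atTop_nat (m + 1))
    refine this.congr fun j => ?_
    simp only [Function.comp, iter_eq]
    rw [show j + (m + 1) = m + 1 + j by ring, show m + 1 + j - 1 = m + j by omega]
  have ht0 : Filter.Tendsto (fun j : ℕ => Real.log 2 / (d : ℝ) ^ (m + j)) Filter.atTop (nhds 0) := by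
    have h := (tendsto_pow_atTop_atTop_of_one_lt hd2).comp (Filter.tendsto_add_atTop_nat m)
    have := h.const_div_atTop (Real.log 2)
    refine this.congr fun j => ?_
    simp [Function.comp, add_comm]
  have key : |gI lam - log⁺ ‖cc d lam (m + 1)‖ / (d : ℝ) ^ m| ≤ kap lam / (d : ℝ) ^ m := by
    have h1 : Filter.Tendsto (fun j : ℕ => |(1 / 2) * Real.log (1 + ‖cc d lam (m + 1 + j)‖ ^ 2)
      / (d : ℝ) ^ (m + j) - log⁺ ‖cc d lam (m + 1)‖ / (d : ℝ) ^ m| - Real.log 2 / (d : ℝ) ^ (m + j))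
        Filter.atTop (nhds (|gI lam - log⁺ ‖cc d lam (m + 1)‖ / (d : ℝ) ^ m| - 0)) :=
      (ht.sub_const _).abs.sub ht0
    rw [sub_zero] at h1
    refine le_of_tendsto' h1 fun j => ?_
    have h2 := ell_tel hd lam m j
    have h3 := half_log_bound (norm_nonneg (cc d lam (m + 1 + j)))
    have h4 : |(1 / 2) * Real.log (1 + ‖cc d lam (m + 1 + j)‖ ^ 2) / (d : ℝ) ^ (m + j) -
        log⁺ ‖cc d lam (m + 1 + j)‖ / (d : ℝ) ^ (m + j)| ≤ Real.log 2 / (d : ℝ) ^ (m + j) := by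
      rw [← sub_div, abs_div, abs_of_pos (show (0 : ℝ) < (d : ℝ) ^ (m + j) by positivity)]
      gcongr
    have h5 := abs_sub_le ((1 / 2) * Real.log (1 + ‖cc d lam (m + 1 + j)‖ ^ 2) / (d : ℝ) ^ (m + j))
      (log⁺ ‖cc d lam (m + 1 + j)‖ / (d : ℝ) ^ (m + j)) (log⁺ ‖cc d lam (m + 1)‖ / (d : ℝ) ^ m)
    have h6 : kap lam * (1 / (d : ℝ) ^ m - 1 / (d : ℝ) ^ (m + j)) ≤ kap lam / (d : ℝ) ^ m := by
      have : kap lam / (d : ℝ) ^ m = kap lam * (1 / (d : ℝ) ^ m) := by ring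
      rw [this]
      have := kap_nonneg lam
      gcongr
      have : 0 < 1 / (d : ℝ) ^ (m + j) := by positivity
      linarith
    linarith
  have hp : (0 : ℝ) < (d : ℝ) ^ m := by positivity
  have : (d : ℝ) ^ (m + 1 - 1) * gI lam - log⁺ ‖cc d lam (m + 1)‖ =
      (d : ℝ) ^ m * (gI lam - log⁺ ‖cc d lam (m + 1)‖ / (d : ℝ) ^ m) := by
    rw [Nat.add_sub_cancel]; field_simp
  rw [this, abs_mul, abs_of_pos hp]
  calc _ ≤ (d : ℝ) ^ m * (kap lam / (d : ℝ) ^ m) := by gcongr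
    _ = _ := by field_simp

lemma log_cc (d : ℕ) (lam : ℂ) (m : ℕ) :
    Real.log ‖cc d lam m‖ = log⁺ ‖cc d lam m‖ - log⁺ (‖cc d lam m‖⁻¹) :=
  posLog_sub_posLog_inv.symm

/-- escape -/
lemma esc {d : ℕ} (hd : 1 < d) {lam : ℂ} {R : ℝ} (hR : 2 ≤ R) (hl : ‖lam‖ ≤ R)
    {k : ℕ} (hk : R ≤ ‖cc d lam k‖) : ∀ j, R ≤ ‖cc d lam (k + j)‖ := by
  intro j
  induction j with
  | zero => exact hk
  | succ j ih =>
    rw [← add_assoc, cc_succ]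
    have h1 : ‖cc d lam (k + j)‖ ^ 2 ≤ ‖cc d lam (k + j)‖ ^ d :=
      pow_le_pow_right₀ (by linarith) hd
    have h2 : ‖cc d lam (k + j) ^ d‖ - ‖lam‖ ≤ ‖cc d lam (k + j) ^ d + lam‖ := by
      have := norm_sub_norm_le (cc d lam (k + j) ^ d) (-lam)
      simpa using this
    rw [norm_pow] at h2
    nlinarith

lemma esc_lam {d : ℕ} (hd : 1 < d) {lam : ℂ} (hl : 2 ≤ ‖lam‖) (k : ℕ) (hk : 1 ≤ k) :
    2 ≤ ‖cc d lam k‖ := by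
  obtain ⟨j, rfl⟩ := Nat.exists_eq_add_of_le hk
  exact hl.trans (esc hd hl le_rfl (by rw [cc_one hd]) j)

lemma pow_diff_le {d : ℕ} {u v : ℂ} (h : ‖u - v‖ ≤ ‖v‖) :
    ‖u ^ d - v ^ d‖ ≤ ‖u - v‖ * (d * (2 * ‖v‖) ^ (d - 1)) := by
  have hu : ‖u‖ ≤ 2 * ‖v‖ := by
    have := norm_add_le (u - v) v
    rw [sub_add_cancel] at this
    linarith
  have hv : ‖v‖ ≤ 2 * ‖v‖ := by linarith [norm_nonneg v]
  rw [← geom_sum₂_mul, norm_mul, mul_comm]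
  gcongr
  calc ‖∑ i ∈ Finset.range d, u ^ i * v ^ (d - 1 - i)‖
      ≤ ∑ i ∈ Finset.range d, (2 * ‖v‖) ^ (d - 1) := by
        refine norm_sum_le_of_le _ fun i hi => ?_
        rw [norm_mul, norm_pow, norm_pow]
        have : i < d := Finset.mem_range.1 hi
        calc ‖u‖ ^ i * ‖v‖ ^ (d - 1 - i) ≤ (2 * ‖v‖) ^ i * (2 * ‖v‖) ^ (d - 1 - i) := by gcongr
          _ = _ := by rw [← pow_add]; congr 1; omega
    _ = _ := by simp

/-- expansion factors -/
noncomputable def ee (d : ℕ) (lam : ℂ) (k : ℕ) : ℝ := d * (2 * ‖cc d lam k‖) ^ (d - 1)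

/-- product of expansion factors -/
noncomputable def EE (d : ℕ) (lam : ℂ) (i j : ℕ) : ℝ := ∏ k ∈ Finset.Ico i j, ee d lam k

lemma ee_nonneg (d : ℕ) (lam : ℂ) (k : ℕ) : 0 ≤ ee d lam k := by unfold ee; positivity

lemma EE_nonneg (d : ℕ) (lam : ℂ) (i j : ℕ) : 0 ≤ EE d lam i j :=
  Finset.prod_nonneg fun k _ => ee_nonneg d lam k

lemma EE_succ (d : ℕ) (lam : ℂ) {i j : ℕ} (h : i ≤ j) :
    EE d lam i (j + 1) = EE d lam i j * ee d lam j := Finset.prod_Ico_succ_top h _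

lemma EE_mul (d : ℕ) (lam : ℂ) {i j k : ℕ} (h : i ≤ j) (h' : j ≤ k) :
    EE d lam i j * EE d lam j k = EE d lam i k := Finset.prod_Ico_consecutive _ h h'

lemma track (d : ℕ) (lam : ℂ) (s t N : ℕ) (D : ℝ) (h0 : ‖cc d lam s - cc d lam t‖ ≤ D)
    (h : ∀ i < N, D * EE d lam t (t + i) ≤ ‖cc d lam (t + i)‖) :
    ∀ i ≤ N, ‖cc d lam (s + i) - cc d lam (t + i)‖ ≤ D * EE d lam t (t + i) := by
  intro i
  induction i with
  | zero => intro _; simpa [EE] using h0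
  | succ i ih =>
    intro hi
    have h1 := ih (by omega)
    have h2 := h i (by omega)
    rw [← add_assoc, ← add_assoc, EE_succ _ _ (by omega), cc_succ, cc_succ,
      add_sub_add_right_eq_sub, ← mul_assoc]
    refine (pow_diff_le (h1.trans h2)).trans ?_
    exact mul_le_mul_of_nonneg_right h1 (ee_nonneg d lam _)

lemma lemA0 {d : ℕ} (hd : 1 < d) (lam : ℂ) (p : ℕ)
    (hx : ∀ a, 1 ≤ a → a < p → ‖cc d lam p‖ < ‖cc d lam a‖ / 2)
    (h4 : ∀ a, 1 ≤ a → a < p → ‖cc d lam a‖ ≤ 4) :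
    1 / 2 ≤ EE d lam 1 p * 4 ^ (d - 1) := by
  rcases Nat.lt_or_ge p 2 with hp | hp
  · have : EE d lam 1 p = 1 := by
      unfold EE; rw [Finset.Ico_eq_empty (by omega)]; simp
    rw [this, one_mul]
    have : (1 : ℝ) ≤ 4 ^ (d - 1) := one_le_pow₀ (by norm_num)
    linarith
  have hd1 : (1 : ℝ) ≤ d := by exact_mod_cast hd.le
  obtain ⟨n0, hn0, hmin⟩ := Finset.exists_min_image (Finset.Ico 1 p) (fun k => ‖cc d lam k‖)
    ⟨1, by simp; omega⟩
  rw [Finset.mem_Ico] at hn0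
  set ρ := ‖cc d lam n0‖ with hρ
  have hmin' : ∀ a, 1 ≤ a → a < p → ρ ≤ ‖cc d lam a‖ := fun a h1 h2 =>
    hmin a (Finset.mem_Ico.2 ⟨h1, h2⟩)
  have hρ0 : 0 < ρ := by
    have := hx n0 hn0.1 hn0.2
    linarith [norm_nonneg (cc d lam p)]
  -- a general bound
  have hee : ∀ a, ‖cc d lam a‖ ^ d * 2 ≤ ‖cc d lam a‖ * ee d lam a := by
    intro a
    unfold ee
    obtain ⟨e, rfl⟩ : ∃ e, d = e + 2 := ⟨d - 2, by omega⟩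
    have h1 : (1 : ℝ) ≤ 2 ^ e := one_le_pow₀ (by norm_num)
    have h2 : (2:ℝ) ≤ ((e + 2 : ℕ) : ℝ) * 2 ^ (e + 1) := by
      push_cast; rw [pow_succ]
      have : (0:ℝ) ≤ e := by positivity
      nlinarith
    have h3 : (0:ℝ) ≤ ‖cc (e + 2) lam a‖ ^ (e + 2) := by positivity
    have : e + 2 - 1 = e + 1 := rfl
    rw [this, mul_pow]
    calc _ ≤ ‖cc (e + 2) lam a‖ ^ (e + 2) * (((e + 2 : ℕ) : ℝ) * 2 ^ (e + 1)) := by gcongr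
      _ = _ := by ring
  -- step (i)
  have hi : ∃ j, 1 ≤ j ∧ j < p ∧ ‖cc d lam j‖ ^ d ≤ EE d lam 1 (j + 1) * ρ ^ d := by
    have : ∃ j, 1 ≤ j ∧ j < p ∧ ‖cc d lam j‖ < 2 * ρ ^ d * EE d lam 1 j := by
      by_contra! hcon
      have h0 : ‖cc d lam (n0 + 1) - cc d lam 1‖ ≤ ρ ^ d := by
        rw [cc_one hd, cc_succ, add_sub_cancel_right, norm_pow]
      have ht := track d lam (n0 + 1) 1 (p - n0 - 1) (ρ ^ d) h0 (by
        intro i hi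
        have h1 := hcon (1 + i) (by omega) (by omega)
        have h2 : 0 ≤ ρ ^ d * EE d lam 1 (1 + i) := mul_nonneg (by positivity) (EE_nonneg _ _ _ _)
        linarith) (p - n0 - 1) le_rfl
      have h1 := hcon (1 + (p - n0 - 1)) (by omega) (by omega)
      have h2 := hx (1 + (p - n0 - 1)) (by omega) (by omega)
      rw [show n0 + 1 + (p - n0 - 1) = p by omega] at ht
      have h3 := norm_sub_norm_le (cc d lam (1 + (p - n0 - 1))) (cc d lam p)
      rw [norm_sub_rev] at h3
      linarith
    obtain ⟨j, hj1, hj2, hj⟩ := this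
    refine ⟨j, hj1, hj2, ?_⟩
    rw [EE_succ _ _ hj1]
    have := mul_le_mul_of_nonneg_right hj.le (ee_nonneg d lam j)
    have h2 := hee j
    nlinarith
  -- step (ii)
  have hfin : ∃ a, (1 ≤ a ∧ a < p ∧ ‖cc d lam a‖ ^ d ≤ EE d lam 1 (a + 1) * ρ ^ d) ∧
      ∀ a', a < a' → a' < p → ¬ (‖cc d lam a'‖ ^ d ≤ EE d lam 1 (a' + 1) * ρ ^ d) := by
    classical
    obtain ⟨j, hj1, hj2, hj⟩ := hi
    obtain ⟨a, ha, hmax⟩ := Finset.exists_max_image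
      ((Finset.Ico 1 p).filter fun a => ‖cc d lam a‖ ^ d ≤ EE d lam 1 (a + 1) * ρ ^ d) id
      ⟨j, by simp only [Finset.mem_filter, Finset.mem_Ico]; exact ⟨⟨hj1, hj2⟩, hj⟩⟩
    simp only [Finset.mem_filter, Finset.mem_Ico, id] at ha hmax
    refine ⟨a, ⟨ha.1.1, ha.1.2, ha.2⟩, fun a' h1 h2 h3 => ?_⟩
    have := hmax a' ⟨⟨by omega, h2⟩, h3⟩
    omega
  obtain ⟨a, ⟨ha1, hap, ha⟩, hmax⟩ := hfin
  have hcond : ∀ a', a < a' → a' < p → ‖cc d lam a‖ ^ d * EE d lam (a + 1) a' ≤ ‖cc d lam a'‖ := by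
    intro a' h1 h2
    by_contra! hcon
    apply hmax a' h1 h2
    have h3 : ‖cc d lam a'‖ ≤ EE d lam 1 a' * ρ ^ d := by
      rw [← EE_mul d lam (show 1 ≤ a + 1 by omega) (show a + 1 ≤ a' by omega)]
      have := mul_le_mul_of_nonneg_right ha (EE_nonneg d lam (a + 1) a')
      nlinarith
    rw [EE_succ _ _ (by omega)]
    have h4 := mul_le_mul_of_nonneg_right h3 (ee_nonneg d lam a')
    have h5 := hee a'
    have h6 : 0 ≤ ‖cc d lam a'‖ ^ d := by positivity
    nlinarith
  have h0 : ‖cc d lam 1 - cc d lam (a + 1)‖ ≤ ‖cc d lam a‖ ^ d := by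
    rw [norm_sub_rev, cc_one hd, cc_succ, add_sub_cancel_right, norm_pow]
  have ht := track d lam 1 (a + 1) (p - a - 1) _ h0 (fun i hi => hcond _ (by omega) (by omega))
    (p - a - 1) le_rfl
  rw [show a + 1 + (p - a - 1) = p by omega] at ht
  have h1 := hmin' (1 + (p - a - 1)) (by omega) (by omega)
  have h2 := hx n0 hn0.1 hn0.2
  have h3 := norm_sub_norm_le (cc d lam (1 + (p - a - 1))) (cc d lam p)
  have h5 : ρ / 2 ≤ EE d lam 1 p * ρ ^ d := by
    rw [← EE_mul d lam (show 1 ≤ a + 1 by omega) (show a + 1 ≤ p by omega)]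
    have := mul_le_mul_of_nonneg_right ha (EE_nonneg d lam (a + 1) p)
    nlinarith
  have h6 : ρ ^ d = ρ * ρ ^ (d - 1) := by
    rw [← pow_succ']; congr 1; omega
  have h7 : 1 / 2 ≤ EE d lam 1 p * ρ ^ (d - 1) := by
    rw [h6] at h5
    have : ρ * (1 / 2) ≤ ρ * (EE d lam 1 p * ρ ^ (d - 1)) := by linarith
    exact le_of_mul_le_mul_left this hρ0
  refine h7.trans ?_
  have := EE_nonneg d lam 1 p
  have := h4 n0 hn0.1 hn0.2
  gcongr

lemma lemA {d : ℕ} (hd : 1 < d) : ∃ A : ℝ, 1 ≤ A ∧ ∀ (lam : ℂ) (p : ℕ), 1 ≤ p →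
    (∀ a, 1 ≤ a → a < p → ‖cc d lam p‖ < ‖cc d lam a‖ / 2) →
    (∀ a, 1 ≤ a → a < p → ‖cc d lam a‖ ≤ 4) →
    1 ≤ A ^ p * ∏ k ∈ Finset.Ico 1 p, ‖cc d lam k‖ := by
  have hd1 : (1 : ℝ) ≤ d := by exact_mod_cast hd.le
  have h2 : (1 : ℝ) ≤ 2 ^ (d - 1) := one_le_pow₀ (by norm_num)
  have h4 : (1 : ℝ) ≤ 4 ^ (d - 1) := one_le_pow₀ (by norm_num)
  have hB : (1 : ℝ) ≤ d * 2 ^ (d - 1) := one_le_mul_of_one_le_of_one_le hd1 h2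
  have hB' : (1 : ℝ) ≤ 2 * 4 ^ (d - 1) := by linarith
  refine ⟨(2 * 4 ^ (d - 1)) * (d * 2 ^ (d - 1)), one_le_mul_of_one_le_of_one_le hB' hB, ?_⟩
  intro lam p hp hx hx4
  set A : ℝ := (2 * 4 ^ (d - 1)) * (d * 2 ^ (d - 1)) with hA
  set Q := ∏ k ∈ Finset.Ico 1 p, ‖cc d lam k‖ with hQ
  have hQ0 : 0 ≤ Q := Finset.prod_nonneg fun _ _ => norm_nonneg _
  have hA1 : 1 ≤ A := one_le_mul_of_one_le_of_one_le hB' hB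
  have h := lemA0 hd lam p hx hx4
  have hE : EE d lam 1 p = (d * 2 ^ (d - 1)) ^ (p - 1) * Q ^ (d - 1) := by
    unfold EE ee
    simp_rw [mul_pow, ← mul_assoc]
    rw [Finset.prod_mul_distrib, Finset.prod_const, Finset.prod_pow, Nat.card_Ico, mul_pow]
  have h1 : 1 ≤ A ^ p * Q ^ (d - 1) := by
    rw [hE] at h
    have h5 : (d * 2 ^ (d - 1) : ℝ) ^ (p - 1) ≤ (d * 2 ^ (d - 1) : ℝ) ^ p :=
      pow_le_pow_right₀ hB (by omega)
    have h6 : (2 * 4 ^ (d - 1) : ℝ) ≤ (2 * 4 ^ (d - 1) : ℝ) ^ p := le_self_pow₀ hB' (by omega)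
    have h7 : 0 ≤ Q ^ (d - 1) := by positivity
    calc (1 : ℝ) ≤ (2 * 4 ^ (d - 1)) * ((d * 2 ^ (d - 1)) ^ (p - 1) * Q ^ (d - 1)) := by linarith
      _ ≤ (2 * 4 ^ (d - 1)) ^ p * ((d * 2 ^ (d - 1)) ^ p * Q ^ (d - 1)) := by gcongr
      _ = _ := by rw [hA, mul_pow]; ring
  have hAp : 1 ≤ A ^ p := one_le_pow₀ hA1
  rcases le_total 1 Q with hQ1 | hQ1
  · exact one_le_mul_of_one_le_of_one_le hAp hQ1
  · have : Q ^ (d - 1) ≤ Q := pow_le_of_le_one hQ0 hQ1 (by omega)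
    refine h1.trans ?_
    gcongr

lemma lint_rpow_ball (s : ℝ) (hs : s < 2) :
    ∫⁻ z in Metric.ball (0 : ℂ) 1, ENNReal.ofReal (‖z‖ ^ (-s)) < ⊤ := by
  have h : IntegrableOn (fun z : ℂ => ‖z‖ ^ (-s)) (Metric.ball 0 1) := by
    refine integrableOn_ball_of_norm_le_rpow (α := s) (C := 1) (by simp) (by simpa using hs)
      (Filter.Eventually.of_forall fun z => ?_) (measurable_norm.pow_const _).aestronglyMeasurable
    rw [one_mul, Real.norm_of_nonneg (by positivity)]
  have := h.lintegral_lt_top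
  exact this

lemma lint_rpow_le (s : ℝ) (hs0 : 0 ≤ s) (hs : s < 2) (R : ℝ) : ∃ M : ℝ, 0 ≤ M ∧ ∀ a : ℂ,
    ∫⁻ z in Metric.ball (0 : ℂ) R, ENNReal.ofReal (‖z - a‖ ^ (-s)) ≤ ENNReal.ofReal M := by
  set J := ∫⁻ z in Metric.ball (0 : ℂ) 1, ENNReal.ofReal (‖z‖ ^ (-s)) with hJ
  have hJf : J < ⊤ := lint_rpow_ball s hs
  have hV : volume (Metric.ball (0 : ℂ) R) < ⊤ := measure_ball_lt_top
  refine ⟨(J + volume (Metric.ball (0 : ℂ) R)).toReal, ENNReal.toReal_nonneg, fun a => ?_⟩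
  rw [ENNReal.ofReal_toReal (ENNReal.add_lt_top.2 ⟨hJf, hV⟩).ne]
  have hJ' : J = ∫⁻ z : ℂ, (Metric.ball (0 : ℂ) 1).indicator
      (fun z => ENNReal.ofReal (‖z‖ ^ (-s))) (z - a) := by
    rw [lintegral_sub_right_eq_self (fun z : ℂ => (Metric.ball (0 : ℂ) 1).indicator
      (fun z => ENNReal.ofReal (‖z‖ ^ (-s))) z), lintegral_indicator measurableSet_ball]
  have hV' : volume (Metric.ball (0 : ℂ) R) = ∫⁻ z : ℂ, (Metric.ball (0 : ℂ) R).indicator 1 z := by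
    rw [lintegral_indicator_one measurableSet_ball]
  rw [hJ', hV', ← lintegral_add_right _ (measurable_one.indicator measurableSet_ball),
    ← lintegral_indicator measurableSet_ball]
  refine lintegral_mono fun z => ?_
  by_cases hz : z ∈ Metric.ball (0 : ℂ) R
  · rw [Set.indicator_of_mem hz, Set.indicator_of_mem hz]
    by_cases hza : z - a ∈ Metric.ball (0 : ℂ) 1
    · rw [Set.indicator_of_mem hza]; exact le_self_add
    · rw [Set.indicator_of_notMem hza, zero_add]
      rw [mem_ball_zero_iff, not_lt] at hza
      simp only [Pi.one_apply]
      rw [ENNReal.ofReal_le_one]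
      exact Real.rpow_le_one_of_one_le_of_nonpos hza (by linarith)
  · rw [Set.indicator_of_notMem hz]; exact zero_le

lemma root_sum {d : ℕ} (hd : 1 < d) {ζ : ℂ} (hζ : IsPrimitiveRoot ζ d) {x y : ℂ}
    (hxy : y ^ d ≠ x ^ d) :
    ∑ j ∈ Finset.range d, ζ ^ (2 * j) / (ζ ^ j * y - x) = d * x * y ^ (d - 2) / (y ^ d - x ^ d) := by
  have hne : y ^ d - x ^ d ≠ 0 := sub_ne_zero.2 hxy
  have h1 : ∀ j, (ζ ^ j * y) ^ d = y ^ d := by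
    intro j
    rw [mul_pow, ← pow_mul, mul_comm j d, pow_mul, hζ.pow_eq_one, one_pow, one_mul]
  have h2 : ∀ j, ζ ^ (2 * j) / (ζ ^ j * y - x) =
      (∑ i ∈ Finset.range d, y ^ i * x ^ (d - 1 - i) * (ζ ^ (i + 2)) ^ j) / (y ^ d - x ^ d) := by
    intro j
    have h3 := geom_sum₂_mul (ζ ^ j * y) x d
    rw [h1] at h3
    have h4 : ζ ^ j * y - x ≠ 0 := by
      intro h; rw [h, mul_zero] at h3; exact hne h3.symm
    rw [div_eq_div_iff h4 hne, ← h3, ← mul_assoc, Finset.mul_sum]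
    congr 1
    refine Finset.sum_congr rfl fun i _ => ?_
    rw [mul_pow, ← pow_mul, ← pow_mul]
    have : ζ ^ (2 * j) * (ζ ^ (j * i) * y ^ i * x ^ (d - 1 - i)) =
      (ζ ^ (2 * j) * ζ ^ (j * i)) * (y ^ i * x ^ (d - 1 - i)) := by ring
    rw [this, ← pow_add, mul_comm]
    congr 2; ring
  have h5 : ∀ i ∈ Finset.range d, i ≠ d - 2 → ∑ j ∈ Finset.range d, (ζ ^ (i + 2)) ^ j = 0 := by
    intro i hi hi2
    have hi' : i < d := Finset.mem_range.1 hi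
    have h6 : ζ ^ (i + 2) ≠ 1 := by
      rw [Ne, hζ.pow_eq_one_iff_dvd]
      rintro ⟨q, hq⟩
      have : q < 2 := by
        by_contra! hq2
        have := Nat.mul_le_mul_left d hq2
        omega
      interval_cases q <;> omega
    have h7 := mul_geom_sum (ζ ^ (i + 2)) d
    rw [← pow_mul, mul_comm (i + 2) d, pow_mul, hζ.pow_eq_one, one_pow, sub_self] at h7
    exact (mul_eq_zero.1 h7).resolve_left (sub_ne_zero.2 h6)
  simp_rw [h2]
  rw [← Finset.sum_div, Finset.sum_comm]
  congr 1
  simp_rw [← Finset.mul_sum]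
  rw [Finset.sum_eq_single (d - 2)]
  · have : ζ ^ (d - 2 + 2) = 1 := by rw [Nat.sub_add_cancel hd, hζ.pow_eq_one]
    rw [this]
    rw [show d - 1 - (d - 2) = 1 by omega]
    simp
    ring
  · intro i hi hi2
    rw [h5 i hi hi2, mul_zero]
  · intro h; exfalso; apply h; rw [Finset.mem_range]; omega

/-- weights -/
noncomputable def bet (d : ℕ) (lam : ℂ) (p k : ℕ) : ℂ :=
  ∏ j ∈ Finset.Ico k p, ((d : ℂ) * cc d lam j ^ (d - 1))

lemma bet_self (d : ℕ) (lam : ℂ) (p : ℕ) : bet d lam p p = 1 := by simp [bet]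

lemma bet_step (d : ℕ) (lam : ℂ) {p k : ℕ} (h : k < p) :
    bet d lam p k = (d : ℂ) * cc d lam k ^ (d - 1) * bet d lam p (k + 1) :=
  Finset.prod_eq_prod_Ico_succ_bot h _

lemma Fp_deriv_sum (d : ℕ) (lam : ℂ) (p : ℕ) :
    (derivative (Fp d p)).eval lam = ∑ k ∈ Finset.Ico 1 (p + 1), bet d lam p k := by
  induction p with
  | zero => simp [Fp]
  | succ p ih =>
    have h1 : (derivative (Fp d (p + 1))).eval lam =
        (d : ℂ) * cc d lam p ^ (d - 1) * (derivative (Fp d p)).eval lam + 1 := by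
      change (derivative ((Fp d p) ^ d + X)).eval lam = _
      simp [derivative_pow, Fp_eval]
    rw [h1, ih, Finset.sum_Ico_succ_top (show 1 ≤ p + 1 by omega) (bet d lam (p + 1)), bet_self,
      Finset.mul_sum]
    congr 1
    refine Finset.sum_congr rfl fun k hk => ?_
    rw [Finset.mem_Ico] at hk
    unfold bet
    rw [Finset.prod_Ico_succ_top (by omega), mul_comm]

/-- the meromorphic function `q` -/
noncomputable def qq (d : ℕ) (lam : ℂ) (p : ℕ) (z : ℂ) : ℂ :=
  ∑ k ∈ Finset.Ico 1 p, bet d lam p k / (z - cc d lam k) + 1 / z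

/-- its push forward -/
noncomputable def HH (d : ℕ) (lam : ℂ) (p : ℕ) (w : ℂ) : ℂ :=
  ∑ k ∈ Finset.Ico 1 (p + 1), bet d lam p k / (w - cc d lam k)
    - (derivative (Fp d p)).eval lam / (w - lam)

lemma transfer {d : ℕ} (hd : 1 < d) {ζ : ℂ} (hζ : IsPrimitiveRoot ζ d) (lam : ℂ) {p : ℕ}
    (hp : 1 ≤ p) {y : ℂ} (hy : y ≠ 0) (hne : ∀ k < p, y ^ d ≠ cc d lam k ^ d) :
    ∑ j ∈ Finset.range d, ζ ^ (2 * j) * qq d lam p (ζ ^ j * y) =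
      (d * y ^ (d - 1)) ^ 2 * HH d lam p (y ^ d + lam) := by
  have hd2 : y ^ (d - 1) * y ^ (d - 1) = y ^ (d - 2) * y ^ d := by
    rw [← pow_add, ← pow_add]; congr 1; omega
  have hyd : y ^ d ≠ 0 := pow_ne_zero _ hy
  have h0 := root_sum hd hζ (x := 0) (y := y) (by rw [zero_pow (by omega)]; exact hyd)
  simp only [sub_zero, mul_zero, zero_mul, zero_div] at h0
  have hL : ∑ j ∈ Finset.range d, ζ ^ (2 * j) * qq d lam p (ζ ^ j * y) =
      ∑ k ∈ Finset.Ico 1 p, bet d lam p k *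
        (d * cc d lam k * y ^ (d - 2) / (y ^ d - cc d lam k ^ d)) := by
    unfold qq
    simp_rw [mul_add, Finset.sum_add_distrib, mul_one_div, h0, add_zero, Finset.mul_sum]
    rw [Finset.sum_comm]
    refine Finset.sum_congr rfl fun k hk => ?_
    rw [Finset.mem_Ico] at hk
    rw [← root_sum hd hζ (hne k hk.2), Finset.mul_sum]
    refine Finset.sum_congr rfl fun j _ => ?_
    ring
  have hk : ∀ k ∈ Finset.Ico 1 p, bet d lam p k *
        (d * cc d lam k * y ^ (d - 2) / (y ^ d - cc d lam k ^ d)) =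
        d ^ 2 * y ^ (d - 2) * (bet d lam p (k + 1) *
          (y ^ d / (y ^ d + lam - cc d lam (k + 1)) - 1)) := by
    intro k hk
    rw [Finset.mem_Ico] at hk
    have h1 : y ^ d - cc d lam k ^ d ≠ 0 := sub_ne_zero.2 (hne k hk.2)
    have h2 : cc d lam k ^ d = cc d lam k ^ (d - 1) * cc d lam k := by
      rw [← pow_succ]; congr 1; omega
    rw [bet_step d lam hk.2, cc_succ, add_sub_add_right_eq_sub]
    field_simp
    rw [h2]; ring
  rw [hL, Finset.sum_congr rfl hk, ← Finset.mul_sum]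
  have hS : ∑ k ∈ Finset.Ico 1 p, bet d lam p (k + 1) *
          (y ^ d / (y ^ d + lam - cc d lam (k + 1)) - 1) =
      y ^ d * HH d lam p (y ^ d + lam) := by
    have h3 : ∑ k ∈ Finset.Ico 1 p, bet d lam p (k + 1) *
          (y ^ d / (y ^ d + lam - cc d lam (k + 1)) - 1) =
          ∑ k ∈ Finset.Ico 1 (p + 1), bet d lam p k *
          (y ^ d / (y ^ d + lam - cc d lam k) - 1) := by
      rw [Finset.sum_eq_sum_Ico_succ_bot (show 1 < p + 1 by omega), cc_one hd, add_sub_cancel_right,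
        div_self hyd, sub_self, mul_zero, zero_add,
        Finset.sum_Ico_add' (fun k => bet d lam p k * (y ^ d / (y ^ d + lam - cc d lam k) - 1))]
    rw [h3]
    unfold HH
    rw [Fp_deriv_sum, mul_sub, add_sub_cancel_right, mul_div_cancel₀ _ hyd, Finset.mul_sum,
      ← Finset.sum_sub_distrib]
    refine Finset.sum_congr rfl fun k _ => ?_
    ring
  rw [hS]
  calc _ = d ^ 2 * (y ^ (d - 2) * y ^ d) * HH d lam p (y ^ d + lam) := by ring
    _ = _ := by rw [← hd2]; ring

lemma qq_HH {d : ℕ} (lam : ℂ) {p : ℕ} (hp : 1 ≤ p) (w : ℂ) (hw : w ≠ 0) (hw' : w ≠ cc d lam p) :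
    ‖qq d lam p w‖ ≤ ‖HH d lam p w‖ + ‖(derivative (Fp d p)).eval lam‖ * ‖w - lam‖⁻¹
      + ‖cc d lam p‖ / (‖w‖ * ‖w - cc d lam p‖) := by
  have h1 : qq d lam p w = HH d lam p w + (derivative (Fp d p)).eval lam * (w - lam)⁻¹
      + (- cc d lam p) / (w * (w - cc d lam p)) := by
    unfold qq HH
    rw [Finset.sum_Ico_succ_top hp, bet_self]
    have : (- cc d lam p) / (w * (w - cc d lam p)) = 1 / w - 1 / (w - cc d lam p) := by
      have := sub_ne_zero.2 hw'
      field_simp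
      ring
    rw [this]
    ring
  rw [h1]
  refine (norm_add₃_le).trans ?_
  simp

lemma lintegral_rot {u : ℂ} (hu : ‖u‖ = 1) {g : ℂ → ENNReal} (hg : Measurable g) :
    ∫⁻ z, g (u * z) = ∫⁻ z, g z := by
  let c : Circle := ⟨u, mem_sphere_zero_iff_norm.2 hu⟩
  have h := ((rotation c).measurePreserving).lintegral_comp hg
  have hz : ∀ z, rotation c z = u * z := fun z => rotation_apply c z
  simp_rw [hz] at h
  exact h

lemma det_mulc (a : ℂ) : |(((ContinuousLinearMap.toSpanSingleton ℂ a).restrictScalars ℝ :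
    ℂ →L[ℝ] ℂ)).det| = ‖a‖ ^ 2 := by
  simp [ContinuousLinearMap.det, LinearMap.det_restrictScalars, Algebra.norm_complex_eq,
    Complex.normSq_eq_norm_sq]

lemma push_ineq {d : ℕ} (hd : 1 < d) {ζ : ℂ} (hζ : IsPrimitiveRoot ζ d) (lam : ℂ)
    {q H : ℂ → ENNReal} (hq : Measurable q) {V : Set ℂ} (hV : MeasurableSet V)
    (hae : ∀ᵐ y : ℂ, ENNReal.ofReal (‖(d : ℂ) * y ^ (d - 1)‖ ^ 2) * H (y ^ d + lam) ≤
      ∑ j ∈ Finset.range d, q (ζ ^ j * y)) :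
    ∫⁻ w in V, H w ≤ ∫⁻ y in (fun y => y ^ d + lam) ⁻¹' V, q y := by
  have hd0 : d ≠ 0 := by omega
  set f : ℂ → ℂ := fun y => y ^ d + lam with hf
  have hfm : Measurable f := by fun_prop
  have hpre : MeasurableSet (f ⁻¹' V) := hfm hV
  set S : Set ℂ := {y | y ≠ 0 ∧ (y ^ d) ^ ((d : ℂ)⁻¹) = y} with hS
  have hSm : MeasurableSet S := by
    apply MeasurableSet.inter
    · exact (measurableSet_singleton (0 : ℂ)).compl
    · exact measurableSet_eq_fun (by fun_prop) measurable_id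
  set T := S ∩ f ⁻¹' V with hT
  have hTm : MeasurableSet T := hSm.inter hpre
  have himg : f '' T = V \ {lam} := by
    ext w
    constructor
    · rintro ⟨y, ⟨⟨hy0, hy⟩, hyV⟩, rfl⟩
      refine ⟨hyV, ?_⟩
      simp [hf, hy0]
    · rintro ⟨hw, hwl⟩
      refine ⟨(w - lam) ^ ((d : ℂ)⁻¹), ⟨⟨?_, ?_⟩, ?_⟩, ?_⟩
      · have h1 := Complex.cpow_nat_inv_pow (w - lam) hd0
        intro h0
        rw [h0, zero_pow hd0] at h1
        exact hwl (sub_eq_zero.1 h1.symm)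
      · rw [Complex.cpow_nat_inv_pow _ hd0]
      · simp only [Set.mem_preimage, hf]
        rw [Complex.cpow_nat_inv_pow _ hd0, sub_add_cancel]; exact hw
      · simp only [hf]
        rw [Complex.cpow_nat_inv_pow _ hd0, sub_add_cancel]
  have hinj : Set.InjOn f T := by
    rintro y ⟨⟨_, hy⟩, _⟩ y' ⟨⟨_, hy'⟩, _⟩ h
    have : y ^ d = y' ^ d := add_right_cancel h
    rw [← hy, this, hy']
  have hder : ∀ x ∈ T, HasFDerivWithinAt f ((ContinuousLinearMap.toSpanSingleton ℂ
      ((d : ℂ) * x ^ (d - 1))).restrictScalars ℝ) T x := by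
    intro x _
    have := ((hasDerivAt_pow d x).add_const lam).hasFDerivAt.restrictScalars ℝ
    exact this.hasFDerivWithinAt
  have h1 : ∫⁻ w in V, H w = ∫⁻ w in V \ {lam}, H w := by
    refine (setLIntegral_congr ?_).symm
    exact sdiff_null_ae_eq_self (measure_singleton lam)
  rw [h1, ← himg, lintegral_image_eq_lintegral_abs_det_fderiv_mul volume hTm hder hinj H]
  simp_rw [det_mulc]
  have hζn : ∀ j, ‖ζ ^ j‖ = 1 := fun j => by rw [norm_pow, hζ.norm'_eq_one hd0, one_pow]
  have hζ0 : ∀ j, ζ ^ j ≠ 0 := fun j => pow_ne_zero _ (hζ.ne_zero hd0)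
  calc _ ≤ ∫⁻ y in T, ∑ j ∈ Finset.range d, q (ζ ^ j * y) :=
        lintegral_mono_ae (ae_restrict_of_ae hae)
    _ = ∑ j ∈ Finset.range d, ∫⁻ y in T, q (ζ ^ j * y) :=
        lintegral_finsetSum _ fun j _ => by fun_prop
    _ = ∑ j ∈ Finset.range d, ∫⁻ z, T.indicator 1 ((ζ ^ j)⁻¹ * z) * q z := by
        refine Finset.sum_congr rfl fun j _ => ?_
        have hm : Measurable fun z => T.indicator (1 : ℂ → ENNReal) ((ζ ^ j)⁻¹ * z) * q z :=
          ((measurable_one.indicator hTm).comp (measurable_const_mul _)).mul hq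
        rw [← lintegral_rot (hζn j) hm, ← lintegral_indicator hTm]
        refine lintegral_congr fun y => ?_
        rw [inv_mul_cancel_left₀ (hζ0 j)]
        by_cases hy : y ∈ T <;> simp [hy]
    _ = ∫⁻ z, ∑ j ∈ Finset.range d, T.indicator 1 ((ζ ^ j)⁻¹ * z) * q z := by
        refine (lintegral_finsetSum _ fun j _ => ?_).symm
        exact ((measurable_one.indicator hTm).comp (measurable_const_mul _)).mul hq
    _ ≤ ∫⁻ z, (f ⁻¹' V).indicator q z := by
        refine lintegral_mono fun z => ?_
        rw [← Finset.sum_mul]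
        have hpow : ∀ j, ((ζ ^ j)⁻¹ * z) ^ d = z ^ d := by
          intro j
          rw [mul_pow, inv_pow, ← pow_mul, mul_comm j d, pow_mul, hζ.pow_eq_one]; simp
        by_cases hz : ∃ j ∈ Finset.range d, (ζ ^ j)⁻¹ * z ∈ T
        · obtain ⟨j, hj, hjT⟩ := hz
          have hzV : z ∈ f ⁻¹' V := by
            have := hjT.2
            simp only [Set.mem_preimage, hf] at this ⊢
            rwa [hpow] at this
          rw [Set.indicator_of_mem hzV, Finset.sum_eq_single j]
          · simp [hjT]
          · intro i hi hij
            rw [Set.indicator_of_notMem]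
            intro hiT
            have e1 := hiT.1.2
            have e2 := hjT.1.2
            rw [hpow] at e1 e2
            have e3 : (ζ ^ i)⁻¹ * z = (ζ ^ j)⁻¹ * z := e1.symm.trans e2
            have hz0 : z ≠ 0 := by
              intro h; apply hjT.1.1; rw [h, mul_zero]
            have e4 := inv_injective (mul_right_cancel₀ hz0 e3)
            exact hij (hζ.pow_inj (Finset.mem_range.1 hi) (Finset.mem_range.1 hj) e4)
          · intro h; exact absurd hj h
        · push Not at hz
          rw [Finset.sum_eq_zero]
          · simp
          · intro j hj
            rw [Set.indicator_of_notMem (hz j hj)]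
    _ = _ := lintegral_indicator hpre _

lemma ae_pow_ne {d : ℕ} (hd : 1 < d) (a : ℂ) : ∀ᵐ y : ℂ, y ^ d ≠ a := by
  have : Set.Finite {y : ℂ | y ^ d = a} := by
    refine (nthRoots d a).toFinset.finite_toSet.subset fun y hy => ?_
    simp only [Finset.mem_coe, Multiset.mem_toFinset]
    exact (mem_nthRoots (by omega)).2 hy
  exact this.countable.ae_notMem volume

lemma qq_meas (d : ℕ) (lam : ℂ) (p : ℕ) : Measurable fun z => ‖qq d lam p z‖ₑ := by
  unfold qq; fun_prop

lemma push_qq {d : ℕ} (hd : 1 < d) (lam : ℂ) {p : ℕ} (hp : 1 ≤ p) {V : Set ℂ}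
    (hV : MeasurableSet V) :
    ∫⁻ w in V, ‖HH d lam p w‖ₑ ≤ ∫⁻ y in (fun y => y ^ d + lam) ⁻¹' V, ‖qq d lam p y‖ₑ := by
  have hζ := Complex.isPrimitiveRoot_exp d (by omega)
  set ζ := Complex.exp (2 * ↑Real.pi * Complex.I / ↑d)
  refine push_ineq hd hζ lam (qq_meas d lam p) hV ?_
  have h1 : ∀ᵐ y : ℂ, ∀ k : ℕ, y ^ d ≠ cc d lam k ^ d := ae_all_iff.2 fun k => ae_pow_ne hd _
  have h2 : ∀ᵐ y : ℂ, y ∉ ({0} : Set ℂ) := (Set.countable_singleton 0).ae_notMem volume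
  filter_upwards [h1, h2] with y hy hy0
  have h := transfer hd hζ lam hp hy0 fun k _ => hy k
  have h3 : ENNReal.ofReal (‖(d : ℂ) * y ^ (d - 1)‖ ^ 2) * ‖HH d lam p (y ^ d + lam)‖ₑ =
      ‖(d * y ^ (d - 1)) ^ 2 * HH d lam p (y ^ d + lam)‖ₑ := by
    rw [enorm_mul, ← norm_pow, ofReal_norm]
  rw [h3, ← h]
  refine (enorm_sum_le _ _).trans (Finset.sum_le_sum fun j _ => ?_)
  rw [enorm_mul, enorm_pow]
  have : ‖ζ‖ₑ = 1 := by rw [← ofReal_norm, hζ.norm'_eq_one (by omega)]; simp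
  rw [this, one_pow, one_mul]

lemma lint_inv (R : ℝ) : ∃ M : ℝ, 0 ≤ M ∧ ∀ a : ℂ,
    ∫⁻ z in Metric.ball (0 : ℂ) R, ENNReal.ofReal (‖z - a‖⁻¹) ≤ ENNReal.ofReal M := by
  obtain ⟨M, hM, h⟩ := lint_rpow_le 1 (by norm_num) (by norm_num) R
  refine ⟨M, hM, fun a => ?_⟩
  simpa [Real.rpow_neg_one] using h a

lemma qq_fin (d : ℕ) (lam : ℂ) (p : ℕ) (R : ℝ) :
    ∫⁻ z in Metric.ball (0 : ℂ) R, ‖qq d lam p z‖ₑ < ⊤ := by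
  obtain ⟨M, hM, h⟩ := lint_inv R
  have hle : ∀ z, ‖qq d lam p z‖ₑ ≤ ∑ k ∈ Finset.Ico 1 p,
      ‖bet d lam p k‖ₑ * ENNReal.ofReal (‖z - cc d lam k‖⁻¹) + ENNReal.ofReal (‖z - 0‖⁻¹) := by
    intro z
    unfold qq
    refine (enorm_add_le _ _).trans (add_le_add ((enorm_sum_le _ _).trans
      (Finset.sum_le_sum fun k _ => ?_)) ?_)
    · rw [div_eq_mul_inv, enorm_mul, ← norm_inv, ofReal_norm]
    · rw [one_div, ← norm_inv, ofReal_norm, sub_zero]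
  refine (lintegral_mono hle).trans_lt ?_
  rw [lintegral_add_right _ (by fun_prop), lintegral_finsetSum _ (fun k _ => by fun_prop)]
  refine ENNReal.add_lt_top.2 ⟨ENNReal.sum_lt_top.2 fun k _ => ?_, ?_⟩
  · rw [lintegral_const_mul _ (by fun_prop)]
    exact ENNReal.mul_lt_top enorm_lt_top ((h _).trans_lt ENNReal.ofReal_lt_top)
  · exact (h _).trans_lt ENNReal.ofReal_lt_top

lemma int_ann_pow {i : ℕ} (hi : i ≠ 0) :
    ∫ z in Metric.ball (0 : ℂ) 10 \ Metric.closedBall 0 5, z ^ i = 0 := by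
  set A := Metric.ball (0 : ℂ) 10 \ Metric.closedBall 0 5 with hA
  have hAm : MeasurableSet A := measurableSet_ball.diff measurableSet_closedBall
  set u : ℂ := Complex.exp (π * Complex.I / i) with hu
  have hui : u ^ i = -1 := by
    rw [hu, ← Complex.exp_nat_mul, mul_div_cancel₀ _ (by exact_mod_cast hi), Complex.exp_pi_mul_I]
  have hun : ‖u‖ = 1 := by
    have : ‖u‖ ^ i = 1 := by rw [← norm_pow, hui]; simp
    exact (pow_eq_one_iff_of_nonneg (norm_nonneg _) hi).1 this
  let c : Circle := ⟨u, mem_sphere_zero_iff_norm.2 hun⟩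
  have h := ((rotation c).measurePreserving).integral_comp
    (rotation c).toHomeomorph.measurableEmbedding (A.indicator fun z : ℂ => z ^ i)
  rw [← integral_indicator hAm]
  have h2 : ∀ z, A.indicator (fun z : ℂ => z ^ i) (rotation c z) =
      - A.indicator (fun z : ℂ => z ^ i) z := by
    intro z
    have hz : (rotation c z) = u * z := rotation_apply c z
    rw [hz]
    have : u * z ∈ A ↔ z ∈ A := by simp [hA, hun]
    by_cases hzA : z ∈ A
    · rw [Set.indicator_of_mem hzA, Set.indicator_of_mem (this.2 hzA), mul_pow, hui]; ring
    · rw [Set.indicator_of_notMem hzA, Set.indicator_of_notMem (fun h => hzA (this.1 h)), neg_zero]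
  simp_rw [h2] at h
  rw [integral_neg] at h
  exact self_eq_neg.1 h.symm

lemma int_ann_poly (P : ℂ[X]) :
    ∫ z in Metric.ball (0 : ℂ) 10 \ Metric.closedBall 0 5, P.eval z =
      (volume (Metric.ball (0 : ℂ) 10 \ Metric.closedBall 0 5)).toReal * P.eval 0 := by
  set A := Metric.ball (0 : ℂ) 10 \ Metric.closedBall 0 5 with hA
  have hintg : ∀ g : ℂ → ℂ, Continuous g → IntegrableOn g A := fun g hg =>
    ((hg.continuousOn (s := Metric.closedBall 0 10)).integrableOn_compact
      (isCompact_closedBall 0 10)).mono_set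
      (Set.sdiff_subset.trans Metric.ball_subset_closedBall)
  simp_rw [eval_eq_sum_range]
  rw [integral_finsetSum _ (fun i _ => hintg _ (by fun_prop))]
  simp_rw [integral_const_mul]
  rw [Finset.sum_eq_single 0, Finset.sum_eq_single 0]
  · simp [Measure.real]; ring
  · intro i _ hi; simp [hi]
  · simp
  · intro i _ hi; rw [int_ann_pow hi, mul_zero]
  · simp

/-- numerator polynomial -/
noncomputable def PP (d : ℕ) (lam : ℂ) (p : ℕ) : ℂ[X] :=
  X * (∑ k ∈ Finset.Ico 1 p, C (bet d lam p k) *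
    ∏ l ∈ (Finset.Ico 1 p).erase k, (X - C (cc d lam l)))
  + ∏ k ∈ Finset.Ico 1 p, (X - C (cc d lam k))

lemma PP_zero (d : ℕ) (lam : ℂ) (p : ℕ) :
    ‖(PP d lam p).eval 0‖ = ∏ k ∈ Finset.Ico 1 p, ‖cc d lam k‖ := by
  simp [PP, eval_prod]

lemma PP_eval (d : ℕ) (lam : ℂ) (p : ℕ) (z : ℂ) (hz : z ≠ 0)
    (hk : ∀ k ∈ Finset.Ico 1 p, z ≠ cc d lam k) :
    (PP d lam p).eval z = z * (∏ k ∈ Finset.Ico 1 p, (z - cc d lam k)) * qq d lam p z := by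
  unfold PP qq
  simp only [eval_add, eval_mul, eval_X, eval_finsetSum, eval_C, eval_prod, eval_sub]
  rw [mul_add, mul_one_div, mul_div_cancel_left₀ _ hz, mul_assoc]
  congr 2
  rw [Finset.mul_sum]
  refine Finset.sum_congr rfl fun k hk' => ?_
  have h1 : z - cc d lam k ≠ 0 := sub_ne_zero.2 (hk k hk')
  rw [← Finset.mul_prod_erase _ _ hk']
  field_simp

lemma lower_qq (d : ℕ) (lam : ℂ) (p : ℕ) (hp : 1 ≤ p)
    (h4 : ∀ k, 1 ≤ k → k < p → ‖cc d lam k‖ ≤ 4) :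
    volume (Metric.ball (0 : ℂ) 10 \ Metric.closedBall 0 5) *
      ENNReal.ofReal (∏ k ∈ Finset.Ico 1 p, ‖cc d lam k‖) ≤
    ENNReal.ofReal (14 ^ p) * ∫⁻ z in Metric.ball (0 : ℂ) 10 \ Metric.closedBall 0 5,
      ‖qq d lam p z‖ₑ := by
  set A := Metric.ball (0 : ℂ) 10 \ Metric.closedBall 0 5 with hA
  have hAm : MeasurableSet A := measurableSet_ball.diff measurableSet_closedBall
  have hAf : volume A ≠ ⊤ := (measure_mono Set.sdiff_subset).trans_lt measure_ball_lt_top |>.ne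
  have h1 : volume A * ENNReal.ofReal (∏ k ∈ Finset.Ico 1 p, ‖cc d lam k‖) =
      ‖∫ z in A, (PP d lam p).eval z‖ₑ := by
    rw [int_ann_poly, ← PP_zero, enorm_mul, ofReal_norm]
    congr 1
    rw [← ofReal_norm, Complex.norm_real, Real.norm_of_nonneg ENNReal.toReal_nonneg,
      ENNReal.ofReal_toReal hAf]
  rw [h1, ← lintegral_const_mul _ (qq_meas d lam p)]
  refine (enorm_integral_le_lintegral_enorm _).trans (setLIntegral_mono' hAm fun z hz => ?_)
  have hz1 : ‖z‖ < 10 := by simpa using hz.1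
  have hz2 : 5 < ‖z‖ := by simpa using hz.2
  rw [PP_eval d lam p z (by rintro rfl; simp at hz2; linarith) (by
    rintro k hk rfl
    rw [Finset.mem_Ico] at hk
    linarith [h4 k hk.1 hk.2]), enorm_mul]
  gcongr
  rw [← ofReal_norm]
  apply ENNReal.ofReal_le_ofReal
  rw [norm_mul, norm_prod]
  have h2 : ∏ k ∈ Finset.Ico 1 p, ‖z - cc d lam k‖ ≤ ∏ k ∈ Finset.Ico 1 p, 14 := by
    refine Finset.prod_le_prod (fun _ _ => norm_nonneg _) fun k hk => ?_
    rw [Finset.mem_Ico] at hk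
    linarith [h4 k hk.1 hk.2, norm_sub_le z (cc d lam k)]
  rw [Finset.prod_const, Nat.card_Ico] at h2
  calc _ ≤ 14 * (14 : ℝ) ^ (p - 1) := by gcongr; linarith
    _ = _ := by rw [← pow_succ']; congr 1; omega

lemma kernel_bound {c w : ℂ} (hw : w ≠ 0) (hwc : w ≠ c) : ‖c‖ / (‖w‖ * ‖w - c‖) ≤
    2 * √‖c‖ * (‖w - 0‖ ^ (-(3/2) : ℝ) + ‖w - c‖ ^ (-(3/2) : ℝ)) := by
  rw [sub_zero]
  set a := √‖w‖ with ha
  set b := √‖w - c‖ with hb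
  set e := √‖c‖ with he
  have ha0 : 0 < a := Real.sqrt_pos.2 (norm_pos_iff.2 hw)
  have hb0 : 0 < b := Real.sqrt_pos.2 (norm_pos_iff.2 (sub_ne_zero.2 hwc))
  have he0 : 0 ≤ e := Real.sqrt_nonneg _
  have ha2 : ‖w‖ = a ^ 2 := (Real.sq_sqrt (norm_nonneg _)).symm
  have hb2 : ‖w - c‖ = b ^ 2 := (Real.sq_sqrt (norm_nonneg _)).symm
  have he2 : ‖c‖ = e ^ 2 := (Real.sq_sqrt (norm_nonneg _)).symm
  have hr : ∀ x : ℝ, 0 < x → (x ^ 2) ^ (-(3/2) : ℝ) = (x ^ 3)⁻¹ := by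
    intro x hx
    rw [← Real.rpow_natCast, ← Real.rpow_mul hx.le, ← Real.rpow_natCast, ← Real.rpow_neg hx.le]
    norm_num
  have htri : e ≤ a + b := by
    have h1 : ‖c‖ ≤ ‖w‖ + ‖w - c‖ := by
      have := norm_sub_le w (w - c); simpa using this
    rw [ha2, hb2, he2] at h1
    exact le_of_sq_le_sq (by nlinarith) (by positivity)
  rw [ha2, hb2, he2, hr a ha0, hr b hb0]
  have h3 : e ^ 2 / (a ^ 2 * b ^ 2) ≤ e * ((a * b ^ 2)⁻¹ + (a ^ 2 * b)⁻¹) := by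
    have : e * ((a * b ^ 2)⁻¹ + (a ^ 2 * b)⁻¹) = e * (a + b) / (a ^ 2 * b ^ 2) := by
      field_simp
    rw [this]; gcongr; nlinarith
  refine h3.trans ?_
  have h4 : (a * b ^ 2)⁻¹ ≤ (a ^ 3)⁻¹ + (b ^ 3)⁻¹ := by
    rcases le_total a b with h | h
    · have : (a * b ^ 2)⁻¹ ≤ (a ^ 3)⁻¹ := by
        apply inv_anti₀ (by positivity); nlinarith [mul_pos ha0 hb0]
      linarith [inv_pos.2 (pow_pos hb0 3)]
    · have : (a * b ^ 2)⁻¹ ≤ (b ^ 3)⁻¹ := by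
        apply inv_anti₀ (by positivity); nlinarith [mul_pos ha0 hb0, pow_pos hb0 2]
      linarith [inv_pos.2 (pow_pos ha0 3)]
  have h5 : (a ^ 2 * b)⁻¹ ≤ (a ^ 3)⁻¹ + (b ^ 3)⁻¹ := by
    rcases le_total a b with h | h
    · have : (a ^ 2 * b)⁻¹ ≤ (a ^ 3)⁻¹ := by
        apply inv_anti₀ (by positivity); nlinarith [mul_pos ha0 hb0, pow_pos ha0 2]
      linarith [inv_pos.2 (pow_pos hb0 3)]
    · have : (a ^ 2 * b)⁻¹ ≤ (b ^ 3)⁻¹ := by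
        apply inv_anti₀ (by positivity); nlinarith [mul_pos ha0 hb0, pow_pos hb0 2]
      linarith [inv_pos.2 (pow_pos ha0 3)]
  calc _ ≤ e * (((a ^ 3)⁻¹ + (b ^ 3)⁻¹) + ((a ^ 3)⁻¹ + (b ^ 3)⁻¹)) := by gcongr
    _ = _ := by ring

lemma lemC {d : ℕ} (hd : 1 < d) : ∃ K : ℝ, 1 ≤ K ∧ ∀ (lam : ℂ) (p : ℕ), 1 ≤ p → ‖lam‖ ≤ 3 →
    (∀ k, 1 ≤ k → k < p → ‖cc d lam k‖ ≤ 4) →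
    ∏ k ∈ Finset.Ico 1 p, ‖cc d lam k‖ ≤
      K ^ p * (‖(derivative (Fp d p)).eval lam‖ + √‖cc d lam p‖) := by
  obtain ⟨M1, hM1, hI1⟩ := lint_inv 10
  obtain ⟨M2, hM2, hI2⟩ := lint_rpow_le (3/2) (by norm_num) (by norm_num) 10
  set A := Metric.ball (0 : ℂ) 10 \ Metric.closedBall 0 5 with hA
  have hAm : MeasurableSet A := measurableSet_ball.diff measurableSet_closedBall
  have hAf : volume A ≠ ⊤ := (measure_mono Set.sdiff_subset).trans_lt measure_ball_lt_top |>.ne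
  have hA0 : 0 < volume A := by
    have hopen : IsOpen A := Metric.isOpen_ball.sdiff Metric.isClosed_closedBall
    refine hopen.measure_pos volume ⟨7, ?_, ?_⟩
    · simp; norm_num
    · simp; norm_num
  set v := (volume A).toReal with hv
  have hv0 : 0 < v := ENNReal.toReal_pos hA0.ne' hAf
  have hvA : volume A = ENNReal.ofReal v := (ENNReal.ofReal_toReal hAf).symm
  set B := max 1 ((M1 + 4 * M2) / v) with hB
  have hB1 : 1 ≤ B := le_max_left _ _
  have hBv : M1 + 4 * M2 ≤ v * B := by
    rw [← div_le_iff₀' hv0]; exact le_max_right _ _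
  refine ⟨14 * B, by linarith, fun lam p hp hl h4 => ?_⟩
  set D := ‖(derivative (Fp d p)).eval lam‖ with hD
  set e := √‖cc d lam p‖ with he
  have hD0 : 0 ≤ D := norm_nonneg _
  have he0 : 0 ≤ e := Real.sqrt_nonneg _
  set V := Metric.ball (0 : ℂ) 10 with hV
  -- upper bound
  have hsub : (fun y : ℂ => y ^ d + lam) ⁻¹' V ⊆ V ∩ Metric.closedBall 0 5 := by
    intro y hy
    have hy' : ‖y ^ d + lam‖ < 10 := by simpa [hV] using hy
    have h5 : ‖y‖ ≤ 5 := by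
      by_contra! hcon
      have h1 : ‖y‖ ^ 2 ≤ ‖y‖ ^ d := pow_le_pow_right₀ (by linarith) hd
      have h2 := norm_sub_norm_le (y ^ d) (-lam)
      rw [norm_neg, sub_neg_eq_add, norm_pow] at h2
      nlinarith
    refine ⟨?_, by simpa using h5⟩
    rw [hV, mem_ball_zero_iff]; linarith
  have hfin5 : ∫⁻ z in V ∩ Metric.closedBall 0 5, ‖qq d lam p z‖ₑ ≠ ⊤ :=
    ((lintegral_mono_set Set.inter_subset_left).trans_lt (qq_fin d lam p 10)).ne
  have hup : ∫⁻ z in A, ‖qq d lam p z‖ₑ ≤ ENNReal.ofReal (D * M1 + 4 * e * M2) := by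
    have hsplit : (∫⁻ z in V ∩ Metric.closedBall 0 5, ‖qq d lam p z‖ₑ) + ∫⁻ z in A, ‖qq d lam p z‖ₑ =
        ∫⁻ z in V, ‖qq d lam p z‖ₑ := lintegral_inter_add_sdiff _ _ measurableSet_closedBall
    have hk : ∫⁻ z in V, ‖qq d lam p z‖ₑ ≤ ∫⁻ z in V, (‖HH d lam p z‖ₑ +
        (ENNReal.ofReal D * ENNReal.ofReal (‖z - lam‖⁻¹) +
         ENNReal.ofReal (2 * e) * (ENNReal.ofReal (‖z - 0‖ ^ (-(3/2) : ℝ)) +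
          ENNReal.ofReal (‖z - cc d lam p‖ ^ (-(3/2) : ℝ))))) := by
      refine lintegral_mono_ae (ae_restrict_of_ae ?_)
      have h1 : ∀ᵐ y : ℂ, y ∉ ({0, cc d lam p} : Set ℂ) :=
        (Set.toFinite {0, cc d lam p}).countable.ae_notMem volume
      filter_upwards [h1] with w hw
      simp only [Set.mem_insert_iff, Set.mem_singleton_iff, not_or] at hw
      have h2 := (qq_HH lam hp w hw.1 hw.2).trans (add_le_add_right
        (kernel_bound hw.1 hw.2) _)
      rw [← ofReal_norm (qq d lam p w), ← ofReal_norm (HH d lam p w), ← ENNReal.ofReal_mul hD0,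
        ← ENNReal.ofReal_add (by positivity) (by positivity), ← ENNReal.ofReal_mul (by positivity),
        ← ENNReal.ofReal_add (by positivity) (by positivity),
        ← ENNReal.ofReal_add (by positivity) (by positivity)]
      apply ENNReal.ofReal_le_ofReal
      linarith
    have hpush := (push_qq hd lam hp (V := V) measurableSet_ball).trans
      (lintegral_mono_set hsub)
    rw [lintegral_add_right _ (by fun_prop), lintegral_add_left (by fun_prop),
      lintegral_const_mul _ (by fun_prop), lintegral_const_mul _ (by fun_prop),
      lintegral_add_left (by fun_prop)] at hk
    have h3 : ENNReal.ofReal D * (∫⁻ z in V, ENNReal.ofReal (‖z - lam‖⁻¹)) +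
        ENNReal.ofReal (2 * e) * ((∫⁻ z in V, ENNReal.ofReal (‖z - 0‖ ^ (-(3/2) : ℝ))) +
          ∫⁻ z in V, ENNReal.ofReal (‖z - cc d lam p‖ ^ (-(3/2) : ℝ))) ≤
        ENNReal.ofReal (D * M1 + 4 * e * M2) := by
      calc _ ≤ ENNReal.ofReal D * ENNReal.ofReal M1 + ENNReal.ofReal (2 * e) *
            (ENNReal.ofReal M2 + ENNReal.ofReal M2) := by
              gcongr
              · exact hI1 _
              · exact hI2 _
              · exact hI2 _
        _ = _ := by
          rw [← ENNReal.ofReal_mul hD0, ← ENNReal.ofReal_add hM2 hM2,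
            ← ENNReal.ofReal_mul (by positivity), ← ENNReal.ofReal_add (by positivity) (by positivity)]
          congr 1; ring
    rw [← hsplit] at hk
    have h4 := hk.trans (add_le_add hpush h3)
    exact (ENNReal.add_le_add_iff_left hfin5).1 h4
  have hlow := lower_qq d lam p hp h4
  rw [← hA, hvA, ← ENNReal.ofReal_mul hv0.le] at hlow
  have hfin := hlow.trans (mul_le_mul_right hup _)
  rw [← ENNReal.ofReal_mul (by positivity), ENNReal.ofReal_le_ofReal_iff (by positivity)] at hfin
  have h6 : D * M1 + 4 * e * M2 ≤ (D + e) * (v * B) := by nlinarith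
  have h7 : v * ∏ k ∈ Finset.Ico 1 p, ‖cc d lam k‖ ≤ v * (14 ^ p * (B * (D + e))) := by
    calc _ ≤ _ := hfin
      _ ≤ 14 ^ p * ((D + e) * (v * B)) := by gcongr
      _ = _ := by ring
  have h8 := le_of_mul_le_mul_left h7 hv0
  refine h8.trans ?_
  have h9 : B ≤ B ^ p := le_self_pow₀ hB1 (by omega)
  rw [mul_pow, mul_assoc]
  gcongr

/-- sum of inverse distances to the roots of `F_p` -/
noncomputable def SS (d p : ℕ) (lam : ℂ) : ℝ := ((Fp d p).roots.map fun a => ‖lam - a‖⁻¹).sum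

/-- the majorant -/
noncomputable def WW (d m : ℕ) (lam : ℂ) : ℝ := (∑ p ∈ Finset.Icc 1 m, SS d p lam) / (d : ℝ) ^ m

lemma SS_nonneg (d p : ℕ) (lam : ℂ) : 0 ≤ SS d p lam := by
  unfold SS
  refine Multiset.sum_nonneg fun x hx => ?_
  obtain ⟨a, _, rfl⟩ := Multiset.mem_map.1 hx
  positivity

lemma WW_nonneg (d m : ℕ) (lam : ℂ) : 0 ≤ WW d m lam :=
  div_nonneg (Finset.sum_nonneg fun _ _ => SS_nonneg _ _ _) (by positivity)

lemma deriv_le_SS (d p : ℕ) (lam : ℂ) (h : cc d lam p ≠ 0) :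
    ‖(derivative (Fp d p)).eval lam‖ ≤ ‖cc d lam p‖ * SS d p lam := by
  have h1 := Polynomial.Splits.eval_derivative_div_eval_of_ne_zero
    (IsAlgClosed.splits (Fp d p)) (x := lam) (by rw [Fp_eval]; exact h)
  rw [Fp_eval, div_eq_iff h] at h1
  rw [h1, norm_mul, mul_comm]
  gcongr
  unfold SS
  refine (norm_multiset_sum_le _).trans ?_
  rw [Multiset.map_map]
  simp

lemma pointwise1 {d : ℕ} (hd : 1 < d) : ∃ C1 : ℝ, 0 ≤ C1 ∧ ∀ (lam : ℂ) (m : ℕ), 1 ≤ m → ‖lam‖ < 3 →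
    (∀ k, 1 ≤ k → k ≤ m → cc d lam k ≠ 0) →
    log⁺ (‖cc d lam m‖⁻¹) ≤ C1 * m + WW d m lam := by
  obtain ⟨A, hA1, hA⟩ := lemA hd
  obtain ⟨K, hK1, hK⟩ := lemC hd
  set L := A * K with hL
  have hL1 : 1 ≤ L := one_le_mul_of_one_le_of_one_le hA1 hK1
  have hd1 : (1 : ℝ) ≤ d := by exact_mod_cast hd.le
  have hG1 : 1 ≤ 8 * L ^ 2 * d := by
    have := one_le_pow₀ hL1 (n := 2)
    nlinarith
  refine ⟨Real.log (8 * L ^ 2 * d), Real.log_nonneg hG1, fun lam m hm hl hne => ?_⟩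
  have hW := WW_nonneg d m lam
  rcases le_or_gt 1 ‖cc d lam m‖ with h1 | h1
  · have : log⁺ (‖cc d lam m‖⁻¹) = 0 := by
      rw [posLog_eq_zero_iff, abs_of_nonneg (by positivity)]
      exact inv_le_one_of_one_le₀ h1
    rw [this]
    have := Real.log_nonneg hG1
    positivity
  set x : ℕ → ℝ := fun k => ‖cc d lam k‖ with hx
  have hx0 : ∀ k, 1 ≤ k → k ≤ m → 0 < x k := fun k h2 h3 => norm_pos_iff.2 (hne k h2 h3)
  have hle4 : ∀ k, k ≤ m → x k ≤ 4 := by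
    intro k hk
    by_contra! hcon
    have := esc hd (R := 3) (by norm_num) hl.le (k := k) (by simp only [hx] at hcon; linarith) (m - k)
    rw [Nat.add_sub_cancel' hk] at this
    linarith
  have hex : ∃ p, 1 ≤ p ∧ p ≤ m ∧ x p ≤ 2 ^ (m - p) * x m := ⟨m, hm, le_rfl, by simp⟩
  classical
  set p := Nat.find hex with hp
  obtain ⟨hp1, hpm, hpx⟩ := Nat.find_spec hex
  rw [← hp] at hp1 hpm hpx
  have hlt : ∀ a, 1 ≤ a → a < p → x p < x a / 2 := by
    intro a ha1 hap
    have h2 := Nat.find_min hex (hp ▸ hap)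
    simp only [not_and, not_le] at h2
    have h3 := h2 ha1 (by omega)
    have h4 : (2 : ℝ) ^ (m - p) * 2 ≤ 2 ^ (m - a) := by
      rw [← pow_succ]; exact pow_le_pow_right₀ (by norm_num) (by omega)
    have := hx0 m hm le_rfl
    nlinarith
  have hA' := hA lam p hp1 hlt (fun a _ h => hle4 a (by omega))
  have hK' := hK lam p hp1 hl.le (fun a _ h => hle4 a (by omega))
  set D := ‖(derivative (Fp d p)).eval lam‖ with hD
  have hA0 : 0 < A := by linarith
  have hL0 : 0 < L := by linarith
  have hd0 : (0 : ℝ) < d := by linarith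
  have hmain : 1 ≤ L ^ p * (D + √(x p)) := by
    refine hA'.trans ?_
    rw [hL, mul_pow, mul_assoc]
    gcongr
  have hxp := hx0 p hp1 hpm
  have hxm := hx0 m hm le_rfl
  have hLp : L ^ p ≤ L ^ m := pow_le_pow_right₀ hL1 hpm
  have h2p : (2 : ℝ) ^ (m - p) ≤ 2 ^ m := pow_le_pow_right₀ (by norm_num) (by omega)
  have hinv : (x m)⁻¹ ≤ 2 ^ m * (x p)⁻¹ := by
    rw [inv_le_iff_one_le_mul₀ hxm, mul_assoc, mul_comm, mul_assoc, ← div_eq_inv_mul, le_div_iff₀ hxp,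
      one_mul, mul_comm]
    refine hpx.trans ?_
    gcongr
  have h8 : (x m)⁻¹ ≤ (8 * L ^ 2 * d) ^ m * (1 + WW d m lam) := by
    have h88 : (8 : ℝ) ^ m = 2 ^ m * 4 ^ m := by rw [← mul_pow]; norm_num
    have e8 : (8 * L ^ 2) ^ m = 2 ^ m * (4 ^ m * (L ^ m) ^ 2) := by
      rw [mul_pow, h88, ← pow_mul, ← pow_mul, mul_comm 2 m, mul_assoc]
    have h4m : (4 : ℝ) ≤ 4 ^ m := le_self_pow₀ (by norm_num) (by omega)
    have h2m : (2 : ℝ) ≤ 2 ^ m := le_self_pow₀ (by norm_num) (by omega)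
    have hdm : (1 : ℝ) ≤ (d : ℝ) ^ m := one_le_pow₀ hd1
    rcases le_or_gt (1 / 2) (L ^ p * √(x p)) with hc | hc
    · have h5 : 1 ≤ 4 * (L ^ p) ^ 2 * x p := by
        have h6 : (1 / 2) ^ 2 ≤ (L ^ p * √(x p)) ^ 2 := by gcongr
        rw [mul_pow, Real.sq_sqrt hxp.le] at h6
        linarith
      have h7 : (x p)⁻¹ ≤ 4 * (L ^ p) ^ 2 := by
        rw [inv_le_iff_one_le_mul₀ hxp]; exact h5
      calc (x m)⁻¹ ≤ 2 ^ m * (x p)⁻¹ := hinv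
        _ ≤ 2 ^ m * (4 ^ m * (L ^ m) ^ 2) := by
            gcongr
            refine h7.trans ?_
            gcongr
        _ = (8 * L ^ 2) ^ m * 1 * 1 := by
            rw [e8]; ring
        _ ≤ (8 * L ^ 2) ^ m * d ^ m * (1 + WW d m lam) := by
            gcongr
            linarith
        _ = _ := by rw [← mul_pow]
    · have h5 : 1 ≤ 2 * L ^ p * D := by nlinarith
      have h6 : D ≤ x p * SS d p lam := deriv_le_SS d p lam (hne p hp1 hpm)
      have h7 : (x p)⁻¹ ≤ 2 * L ^ p * SS d p lam := by
        rw [inv_le_iff_one_le_mul₀ hxp]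
        have : 0 < L ^ p := by positivity
        calc (1 : ℝ) ≤ 2 * L ^ p * D := h5
          _ ≤ 2 * L ^ p * (x p * SS d p lam) := by gcongr
          _ = _ := by ring
      have h9 : SS d p lam ≤ d ^ m * WW d m lam := by
        unfold WW
        rw [mul_div_cancel₀ _ (by positivity)]
        exact Finset.single_le_sum (fun i _ => SS_nonneg d i lam) (Finset.mem_Icc.2 ⟨hp1, hpm⟩)
      have hLL : L ^ m ≤ (L ^ m) ^ 2 := le_self_pow₀ (one_le_pow₀ hL1) (by norm_num)
      calc (x m)⁻¹ ≤ 2 ^ m * (x p)⁻¹ := hinv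
        _ ≤ 2 ^ m * (4 ^ m * (L ^ m) ^ 2 * (d ^ m * WW d m lam)) := by
            gcongr
            refine h7.trans ?_
            have := SS_nonneg d p lam
            gcongr
            · linarith
            · exact hLp.trans hLL
        _ = (8 * L ^ 2 * d) ^ m * WW d m lam := by
            rw [mul_pow (8 * L ^ 2), e8]; ring
        _ ≤ _ := by gcongr; linarith
  have h9 : log⁺ ((x m)⁻¹) = Real.log ((x m)⁻¹) := by
    apply posLog_eq_log
    rw [abs_of_pos (by positivity)]
    exact (one_le_inv₀ hxm).2 h1.le
  rw [show ‖cc d lam m‖ = x m from rfl, h9]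
  calc _ ≤ Real.log ((8 * L ^ 2 * d) ^ m * (1 + WW d m lam)) := Real.log_le_log (by positivity) h8
    _ = m * Real.log (8 * L ^ 2 * d) + Real.log (1 + WW d m lam) := by
      rw [Real.log_mul (by positivity) (by positivity), Real.log_pow]
    _ ≤ _ := by
      have := Real.log_le_sub_one_of_pos (show 0 < 1 + WW d m lam by positivity)
      linarith

lemma int_inv (R : ℝ) : ∃ M : ℝ, 0 ≤ M ∧ ∀ a : ℂ,
    IntegrableOn (fun z : ℂ => ‖z - a‖⁻¹) (Metric.ball 0 R) ∧
    ∫ z in Metric.ball (0 : ℂ) R, ‖z - a‖⁻¹ ≤ M := by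
  obtain ⟨M, hM, h⟩ := lint_inv R
  refine ⟨M, hM, fun a => ⟨⟨by fun_prop, ?_⟩, ?_⟩⟩
  · rw [hasFiniteIntegral_iff_ofReal (Filter.Eventually.of_forall fun z => by positivity)]
    exact (h a).trans_lt ENNReal.ofReal_lt_top
  · rw [integral_eq_lintegral_of_nonneg_ae (Filter.Eventually.of_forall fun z => by positivity)
      (by fun_prop)]
    exact ENNReal.toReal_le_of_le_ofReal hM (h a)

lemma multiset_int (s : Multiset ℂ) {R M : ℝ}
    (h : ∀ a : ℂ, IntegrableOn (fun z : ℂ => ‖z - a‖⁻¹) (Metric.ball 0 R) ∧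
      ∫ z in Metric.ball (0 : ℂ) R, ‖z - a‖⁻¹ ≤ M) :
    IntegrableOn (fun z : ℂ => (s.map fun a => ‖z - a‖⁻¹).sum) (Metric.ball 0 R) ∧
      ∫ z in Metric.ball (0 : ℂ) R, (s.map fun a => ‖z - a‖⁻¹).sum ≤ s.card * M := by
  induction s using Multiset.induction_on with
  | empty => simp
  | cons a s ih =>
    simp only [Multiset.map_cons, Multiset.sum_cons, Multiset.card_cons]
    refine ⟨(h a).1.add ih.1, ?_⟩
    rw [integral_add (h a).1 ih.1]
    push_cast
    linarith [(h a).2, ih.2]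

lemma WW_int {d : ℕ} (hd : 1 < d) : ∃ C2 : ℝ, 0 ≤ C2 ∧ ∀ m : ℕ,
    IntegrableOn (WW d m) (Metric.ball 0 3) ∧ ∫ z in Metric.ball (0 : ℂ) 3, WW d m z ≤ C2 := by
  obtain ⟨M, hM, h⟩ := int_inv 3
  refine ⟨M, hM, fun m => ?_⟩
  have hS : ∀ p, 1 ≤ p → IntegrableOn (SS d p) (Metric.ball 0 3) ∧
      ∫ z in Metric.ball (0 : ℂ) 3, SS d p z ≤ (d : ℝ) ^ (p - 1) * M := by
    intro p hp
    have := multiset_int (Fp d p).roots h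
    rw [Fp_card_roots hd hp] at this
    push_cast at this
    exact this
  have hI : ∀ p ∈ Finset.Icc 1 m, IntegrableOn (SS d p) (Metric.ball 0 3) := fun p hp =>
    (hS p (Finset.mem_Icc.1 hp).1).1
  have hd0 : (0 : ℝ) < d := by positivity
  have hd2 : (2 : ℝ) ≤ d := by exact_mod_cast hd
  have hgeom : ∀ m : ℕ, ∑ p ∈ Finset.Icc 1 m, (d : ℝ) ^ (p - 1) ≤ (d : ℝ) ^ m := by
    intro m
    induction m with
    | zero => simp
    | succ m ih =>
      rw [Finset.sum_Icc_succ_top (by omega), Nat.add_sub_cancel, pow_succ]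
      have : (0 : ℝ) < (d : ℝ) ^ m := by positivity
      nlinarith
  refine ⟨?_, ?_⟩
  · exact (integrable_finsetSum _ hI).div_const _
  · unfold WW
    rw [integral_div, integral_finsetSum _ hI, div_le_iff₀ (by positivity)]
    calc _ ≤ ∑ p ∈ Finset.Icc 1 m, (d : ℝ) ^ (p - 1) * M :=
          Finset.sum_le_sum fun p hp => (hS p (Finset.mem_Icc.1 hp).1).2
      _ = (∑ p ∈ Finset.Icc 1 m, (d : ℝ) ^ (p - 1)) * M := by rw [Finset.sum_mul]
      _ ≤ (d : ℝ) ^ m * M := by gcongr; exact hgeom m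
      _ = _ := by ring

lemma pow_diff_le2 {d : ℕ} {u v : ℂ} {r : ℝ} (hu : ‖u‖ ≤ r) (hv : ‖v‖ ≤ r) :
    ‖u ^ d - v ^ d‖ ≤ d * r ^ (d - 1) * ‖u - v‖ := by
  rw [← geom_sum₂_mul, norm_mul]
  gcongr
  calc ‖∑ i ∈ Finset.range d, u ^ i * v ^ (d - 1 - i)‖
      ≤ ∑ i ∈ Finset.range d, r ^ (d - 1) := by
        refine norm_sum_le_of_le _ fun i hi => ?_
        rw [norm_mul, norm_pow, norm_pow]
        have : i < d := Finset.mem_range.1 hi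
        have hr : 0 ≤ r := (norm_nonneg _).trans hu
        calc ‖u‖ ^ i * ‖v‖ ^ (d - 1 - i) ≤ r ^ i * r ^ (d - 1 - i) := by gcongr
          _ = _ := by rw [← pow_add]; congr 1; omega
    _ = _ := by simp

lemma przy {d : ℕ} (hd : 1 < d) (lam : ℂ) (hne : ∀ k, 1 ≤ k → cc d lam k ≠ 0) (L'' : ℝ)
    (hL'' : (d : ℝ) ^ 2 < L'') :
    ∀ᶠ n : ℕ in Filter.atTop, 1 ≤ L'' ^ n * ‖cc d lam n‖ ^ (d - 1) := by
  have hd2 : (2 : ℝ) ≤ d := by exact_mod_cast hd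
  have hd0 : (0 : ℝ) < d := by linarith
  have hL''1 : 1 < L'' := by nlinarith
  have hdm : d - 1 ≠ 0 := by omega
  by_cases hesc : ∃ k, 1 ≤ k ∧ ‖lam‖ ≤ ‖cc d lam k‖ ∧ 2 < ‖cc d lam k‖ ^ (d - 1)
  · obtain ⟨k, hk1, hkl, hk2⟩ := hesc
    have h : ∀ j, ‖cc d lam k‖ ≤ ‖cc d lam (k + j)‖ := by
      intro j
      induction j with
      | zero => exact le_rfl
      | succ j ih =>
        rw [← add_assoc, cc_succ]
        have h1 : ‖cc d lam (k + j) ^ d‖ - ‖lam‖ ≤ ‖cc d lam (k + j) ^ d + lam‖ := by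
          have := norm_sub_norm_le (cc d lam (k + j) ^ d) (-lam)
          simpa using this
        have h2 : ‖cc d lam (k + j)‖ ^ d = ‖cc d lam (k + j)‖ ^ (d - 1) * ‖cc d lam (k + j)‖ := by
          rw [← pow_succ]; congr 1; omega
        have h3 : ‖cc d lam k‖ ^ (d - 1) ≤ ‖cc d lam (k + j)‖ ^ (d - 1) := by gcongr
        rw [norm_pow, h2] at h1
        have := norm_nonneg (cc d lam (k + j))
        nlinarith
    filter_upwards [Filter.eventually_ge_atTop k] with n hn
    obtain ⟨j, rfl⟩ := Nat.exists_eq_add_of_le hn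
    have h3 : ‖cc d lam k‖ ^ (d - 1) ≤ ‖cc d lam (k + j)‖ ^ (d - 1) := by
      gcongr; exact h j
    exact one_le_mul_of_one_le_of_one_le (one_le_pow₀ hL''1.le) (by linarith)
  push Not at hesc
  have hl2 : ‖lam‖ ^ (d - 1) ≤ 2 := by
    have := hesc 1 le_rfl (by rw [cc_one hd])
    rwa [cc_one hd] at this
  have hb2 : ∀ k, ‖cc d lam k‖ ^ (d - 1) ≤ 2 := by
    intro k
    rcases Nat.eq_zero_or_pos k with rfl | hk
    · rw [cc_zero, norm_zero, zero_pow hdm]; norm_num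
    · rcases le_or_gt ‖lam‖ ‖cc d lam k‖ with h | h
      · exact hesc k hk h
      · exact le_trans (by gcongr) hl2
  obtain ⟨r0, hr0, hr0p⟩ : ∃ r : ℝ, 0 ≤ r ∧ r ^ (d - 1) = 2 :=
    ⟨(2 : ℝ) ^ (((d - 1 : ℕ) : ℝ)⁻¹), by positivity, Real.rpow_inv_natCast_pow (by norm_num) hdm⟩
  have hbr : ∀ k, ‖cc d lam k‖ ≤ r0 := fun k =>
    le_of_pow_le_pow_left₀ hdm hr0 (by rw [hr0p]; exact hb2 k)
  obtain ⟨L, hL1, hL2⟩ := exists_between hL''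
  have hL0 : 1 < L := by nlinarith
  obtain ⟨δ, hδ0, hδ⟩ : ∃ δ : ℝ, 0 < δ ∧ d * (r0 + δ) ^ (d - 1) ≤ L := by
    have hc : Filter.Tendsto (fun δ : ℝ => d * (r0 + δ) ^ (d - 1)) (nhdsWithin 0 (Set.Ioi 0))
        (nhds (d * (r0 + 0) ^ (d - 1))) := by
      apply Filter.Tendsto.mono_left _ nhdsWithin_le_nhds
      exact Continuous.tendsto (f := fun δ : ℝ => d * (r0 + δ) ^ (d - 1)) (by fun_prop) 0
    rw [add_zero, hr0p] at hc
    have h1 : (d : ℝ) * 2 < L := by nlinarith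
    obtain ⟨δ, h2, h3⟩ := ((hc.eventually (gt_mem_nhds h1)).and self_mem_nhdsWithin).exists
    exact ⟨δ, h3, h2.le⟩
  -- tracking
  have htr : ∀ (n s : ℕ) (t : ℝ), 0 < t → L ^ n * (2 * t) ^ d ≤ δ → ‖cc d lam s‖ ≤ 2 * t →
      ∀ i, i + 1 ≤ n → ‖cc d lam (s + (i + 1)) - cc d lam (i + 1)‖ ≤ L ^ i * (2 * t) ^ d := by
    intro n s t ht hn hs i
    induction i with
    | zero =>
      intro _
      rw [zero_add, cc_one hd, cc_succ, add_sub_cancel_right, norm_pow, pow_zero, one_mul]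
      gcongr
    | succ i ih =>
      intro hi
      have h1 := ih (by omega)
      have h2 : L ^ i * (2 * t) ^ d ≤ δ := by
        refine le_trans ?_ hn
        gcongr
        · exact hL0.le
        · omega
      have h3 : ‖cc d lam (s + (i + 1))‖ ≤ r0 + δ := by
        have := norm_add_le (cc d lam (s + (i + 1)) - cc d lam (i + 1)) (cc d lam (i + 1))
        rw [sub_add_cancel] at this
        linarith [hbr (i + 1)]
      have h4 : ‖cc d lam (i + 1)‖ ≤ r0 + δ := by linarith [hbr (i + 1)]
      rw [show s + (i + 1 + 1) = (s + (i + 1)) + 1 by ring, cc_succ d lam (s + (i + 1)),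
        cc_succ d lam (i + 1), add_sub_add_right_eq_sub]
      refine (pow_diff_le2 h3 h4).trans ?_
      calc _ ≤ L * (L ^ i * (2 * t) ^ d) := by gcongr
        _ = _ := by ring
  have hstar : ∀ n, 1 ≤ n → L ^ n * (2 * ‖cc d lam n‖) ^ d ≤ δ →
      L ^ n * (2 * ‖cc d lam n‖) ^ d ≤ ‖cc d lam n‖ / 2 → ∀ k, 1 ≤ k →
      ‖cc d lam n‖ / 2 ≤ ‖cc d lam (k * n)‖ ∧ ‖cc d lam (k * n)‖ ≤ 3 / 2 * ‖cc d lam n‖ := by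
    intro n hn h1 h2 k hk
    have ht : 0 < ‖cc d lam n‖ := norm_pos_iff.2 (hne n hn)
    induction k, hk using Nat.le_induction with
    | base => rw [one_mul]; constructor <;> linarith
    | succ k hk ih =>
      have h3 := htr n (k * n) _ ht h1 (by linarith [ih.2]) (n - 1) (by omega)
      rw [Nat.sub_add_cancel hn] at h3
      have h4 : L ^ (n - 1) * (2 * ‖cc d lam n‖) ^ d ≤ ‖cc d lam n‖ / 2 := by
        refine le_trans ?_ h2
        gcongr
        · exact hL0.le
        · omega
      have h5 := norm_sub_norm_le (cc d lam (k * n + n)) (cc d lam n)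
      have h6 := norm_sub_norm_le (cc d lam n) (cc d lam (k * n + n))
      rw [norm_sub_rev] at h6
      rw [add_mul, one_mul]
      constructor <;> linarith
  by_contra hcon
  rw [Filter.not_eventually] at hcon
  -- eventual smallness
  have hsmall : ∀ ε : ℝ, 0 < ε → ∀ᶠ n : ℕ in Filter.atTop,
      ¬ (1 ≤ L'' ^ n * ‖cc d lam n‖ ^ (d - 1)) → ‖cc d lam n‖ < ε := by
    intro ε hε
    have h1 := (tendsto_pow_atTop_atTop_of_one_lt hL''1).eventually_ge_atTop ((ε ^ (d - 1))⁻¹)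
    filter_upwards [h1] with n hn hbad
    by_contra! hge
    apply hbad
    have h2 : ε ^ (d - 1) ≤ ‖cc d lam n‖ ^ (d - 1) := by gcongr
    have h3 : 0 < ε ^ (d - 1) := by positivity
    calc (1 : ℝ) = (ε ^ (d - 1))⁻¹ * ε ^ (d - 1) := by field_simp
      _ ≤ _ := by gcongr
  have hratio : ∀ᶠ n : ℕ in Filter.atTop, 2 ^ (d + 1) * (L / L'') ^ n ≤ 1 := by
    have h1 : Filter.Tendsto (fun n : ℕ => 2 ^ (d + 1) * (L / L'') ^ n) Filter.atTop
        (nhds (2 ^ (d + 1) * 0)) :=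
      (tendsto_pow_atTop_nhds_zero_of_lt_one (by positivity)
        ((div_lt_one (by linarith)).2 hL2)).const_mul _
    rw [mul_zero] at h1
    filter_upwards [h1.eventually (gt_mem_nhds one_pos)] with n hn using hn.le
  have hgood : ∀ᶠ n : ℕ in Filter.atTop, ¬ (1 ≤ L'' ^ n * ‖cc d lam n‖ ^ (d - 1)) →
      1 ≤ n ∧ L ^ n * (2 * ‖cc d lam n‖) ^ d ≤ δ ∧
      L ^ n * (2 * ‖cc d lam n‖) ^ d ≤ ‖cc d lam n‖ / 2 := by
    filter_upwards [hsmall (2 * δ) (by positivity), hratio, Filter.eventually_ge_atTop 1]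
      with n h1 h2 h3 hbad
    have h4 : L ^ n * (2 * ‖cc d lam n‖) ^ d ≤ ‖cc d lam n‖ / 2 := by
      have h5 : ‖cc d lam n‖ ^ d = ‖cc d lam n‖ ^ (d - 1) * ‖cc d lam n‖ := by
        rw [← pow_succ]; congr 1; omega
      push Not at hbad
      have h6 : L ^ n = (L / L'') ^ n * L'' ^ n := by
        rw [← mul_pow, div_mul_cancel₀ _ (by linarith)]
      have h7 : 0 ≤ (L / L'') ^ n := by positivity
      rw [mul_pow, h5, h6]
      calc (L / L'') ^ n * L'' ^ n * (2 ^ d * (‖cc d lam n‖ ^ (d - 1) * ‖cc d lam n‖))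
          = (2 ^ (d + 1) * (L / L'') ^ n) * (L'' ^ n * ‖cc d lam n‖ ^ (d - 1)) *
              (‖cc d lam n‖ / 2) := by ring
        _ ≤ 1 * 1 * (‖cc d lam n‖ / 2) := by gcongr
        _ = _ := by ring
    exact ⟨h3, by linarith [h1 hbad], h4⟩
  obtain ⟨n1, hbad1, hg1⟩ := (hcon.and_eventually hgood).exists
  obtain ⟨hn1, ha1, hb1⟩ := hg1 hbad1
  have ht1 : 0 < ‖cc d lam n1‖ := norm_pos_iff.2 (hne n1 hn1)
  obtain ⟨n2, hbad2, hg2, hs2⟩ := (hcon.and_eventually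
    (hgood.and (hsmall (‖cc d lam n1‖ / 4) (by positivity)))).exists
  obtain ⟨hn2, ha2, hb2'⟩ := hg2 hbad2
  have h1 := hstar n1 hn1 ha1 hb1 n2 hn2
  have h2 := hstar n2 hn2 ha2 hb2' n1 hn1
  rw [mul_comm] at h2
  linarith [hs2 hbad2, h1.1, h2.2]

noncomputable def dens (z : ℂ) : ℝ := (π * (1 + ‖z‖ ^ 2) ^ 2)⁻¹

lemma dens_nonneg (z : ℂ) : 0 ≤ dens z := by unfold dens; positivity

lemma dens_le (z : ℂ) : dens z ≤ π⁻¹ := by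
  unfold dens
  have : (1 : ℝ) ≤ (1 + ‖z‖ ^ 2) ^ 2 := by
    apply one_le_pow₀
    nlinarith [sq_nonneg ‖z‖]
  gcongr
  nlinarith [pi_pos]

lemma dens_cont : Continuous dens := by
  unfold dens
  refine Continuous.inv₀ (by fun_prop) fun z => ?_
  positivity

lemma dens_ball : ∫ z in Metric.ball (0 : ℂ) 3, dens z = 9 / 10 := by
  have h1 : ∫ z in Metric.ball (0 : ℂ) 3, dens z =
      ∫ z : ℂ, (Set.Iio (3 : ℝ)).indicator (fun y => (π * (1 + y ^ 2) ^ 2)⁻¹) ‖z‖ := by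
    rw [← integral_indicator Metric.isOpen_ball.measurableSet]
    congr 1
    ext z
    simp [Set.indicator, dens]
  rw [h1, integral_fun_norm_addHaar volume
    (fun y : ℝ => (Set.Iio (3 : ℝ)).indicator (fun y => (π * (1 + y ^ 2) ^ 2)⁻¹) y)]
  have h2 : ∫ y in Set.Ioi (0 : ℝ), y ^ (Module.finrank ℝ ℂ - 1) •
      (Set.Iio (3 : ℝ)).indicator (fun y => (π * (1 + y ^ 2) ^ 2)⁻¹) y = 9 / (20 * π) := by
    have : ∀ y : ℝ, y ^ (Module.finrank ℝ ℂ - 1) •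
      (Set.Iio (3 : ℝ)).indicator (fun y => (π * (1 + y ^ 2) ^ 2)⁻¹) y =
      (Set.Iio (3 : ℝ)).indicator (fun y => y * (π * (1 + y ^ 2) ^ 2)⁻¹) y := by
      intro y
      simp [Set.indicator, Complex.finrank_real_complex]
    simp_rw [this]
    rw [setIntegral_indicator measurableSet_Iio, Set.Ioi_inter_Iio,
      ← integral_Ioc_eq_integral_Ioo, ← intervalIntegral.integral_of_le (by norm_num)]
    rw [intervalIntegral.integral_eq_sub_of_hasDerivAt
      (f := fun y => - (2 * π * (1 + y ^ 2))⁻¹)]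
    · field_simp
      norm_num
    · intro x _
      have h0 : (2 * π * (1 + x ^ 2)) ≠ 0 := by positivity
      have := ((((hasDerivAt_id x).pow 2).const_add 1).const_mul (2 * π)).inv h0 |>.neg
      refine HasDerivAt.congr_deriv this ?_
      simp only [id, Pi.pow_apply]
      push_cast
      field_simp
    · apply Continuous.intervalIntegrable
      apply continuous_id.mul
      refine Continuous.inv₀ (by fun_prop) fun z => ?_
      positivity
  rw [h2, Complex.finrank_real_complex, Measure.real, Complex.volume_ball]
  simp
  field_simp
  norm_num

lemma cc_cont (d m : ℕ) : Continuous fun lam : ℂ => cc d lam m := by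
  simp_rw [← Fp_eval]
  exact (Fp d m).continuous

lemma cc_ae {d : ℕ} (hd : 1 < d) : ∀ᵐ lam : ℂ, ∀ k, 1 ≤ k → cc d lam k ≠ 0 := by
  rw [ae_all_iff]
  intro k
  by_cases hk : 1 ≤ k
  · have hc : ((Fp d k).rootSet ℂ).Countable := (rootSet_finite (Fp d k) ℂ).countable
    filter_upwards [hc.ae_notMem volume] with lam h _ h0
    apply h
    rw [mem_rootSet]
    refine ⟨Fp_ne_zero hd hk, ?_⟩
    rw [← h0, ← Fp_eval]
    simp
  · exact Filter.Eventually.of_forall fun _ h => absurd h hk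

lemma lp_int {d : ℕ} (hd : 1 < d) : ∃ C : ℝ, 0 ≤ C ∧ ∀ m : ℕ, 1 ≤ m →
    Integrable (fun lam : ℂ => log⁺ (‖cc d lam m‖⁻¹) * dens lam) ∧
    ((d : ℝ) - 1) * ∫ lam : ℂ, log⁺ (‖cc d lam m‖⁻¹) * dens lam ≤ 2 * m * Real.log d + C := by
  obtain ⟨C1, hC1, hp⟩ := pointwise1 hd
  obtain ⟨C2, hC2, hW⟩ := WW_int hd
  have hd1 : (1 : ℝ) < d := by exact_mod_cast hd
  have hlog : 0 < Real.log d := Real.log_pos hd1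
  set L : ℝ := Real.exp (2.2 * Real.log d) with hL
  have hLd : (d : ℝ) ^ 2 < L := by
    have : (d : ℝ) ^ 2 = Real.exp (2 * Real.log d) := by
      rw [mul_comm, Real.exp_mul, Real.exp_log (by linarith)]
      norm_cast
    rw [this, hL]
    apply Real.exp_lt_exp.2
    nlinarith
  set B : ℕ → Set ℂ := fun m => Metric.ball 0 3 ∩ {lam | L ^ m * ‖cc d lam m‖ ^ (d - 1) < 1} with hB
  have hBm : ∀ m, MeasurableSet (B m) := by
    intro m
    refine Metric.isOpen_ball.measurableSet.inter (IsOpen.measurableSet ?_)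
    exact isOpen_lt (continuous_const.mul ((cc_cont d m).norm.pow _)) continuous_const
  have hfin : volume (Metric.ball (0 : ℂ) 3) ≠ ⊤ := measure_ball_lt_top.ne
  have hBt : Filter.Tendsto (fun m => volume (B m)) Filter.atTop (nhds 0) := by
    have := tendsto_measure_of_ae_tendsto_indicator (μ := (volume : Measure ℂ)) Filter.atTop
      (A := ∅) MeasurableSet.empty hBm
      Metric.isOpen_ball.measurableSet hfin (Filter.Eventually.of_forall fun m => Set.inter_subset_left)
      (by
        filter_upwards [cc_ae hd] with lam hl
        filter_upwards [przy hd lam hl L hLd] with n hn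
        simp only [Set.mem_empty_iff_false, iff_false]
        rintro ⟨_, h⟩
        exact absurd hn (not_le.2 h))
    simpa using this
  have hBr : Filter.Tendsto (fun m => volume.real (B m)) Filter.atTop (nhds 0) := by
    have := (ENNReal.tendsto_toReal ENNReal.zero_ne_top).comp hBt
    rw [ENNReal.toReal_zero] at this
    exact this
  have hBle : ∀ m, volume.real (B m) ≤ 9 * π := by
    intro m
    calc volume.real (B m) ≤ volume.real (Metric.ball (0 : ℂ) 3) :=
          measureReal_mono Set.inter_subset_left hfin
      _ = 9 * π := by
          rw [Measure.real, Complex.volume_ball]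
          simp
          norm_num
  obtain ⟨m0, hm0⟩ : ∃ m0 : ℕ, ∀ m ≥ m0, ((d : ℝ) - 1) * C1 * π⁻¹ * volume.real (B m) ≤
      0.02 * Real.log d := by
    have := hBr.const_mul (((d : ℝ) - 1) * C1 * π⁻¹)
    rw [mul_zero] at this
    have := this.eventually (ge_mem_nhds (show (0:ℝ) < 0.02 * Real.log d by positivity))
    exact Filter.eventually_atTop.1 this
  have hd10 : 0 < (d : ℝ) - 1 := by linarith
  refine ⟨((d : ℝ) - 1) * C2 * π⁻¹ + ((d : ℝ) - 1) * C1 * π⁻¹ * m0 * (9 * π), by positivity,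
    fun m hm => ?_⟩
  have hzero : ∀ lam, lam ∉ Metric.ball (0 : ℂ) 3 → log⁺ (‖cc d lam m‖⁻¹) * dens lam = 0 := by
    intro lam hl
    have h3 : 3 ≤ ‖lam‖ := by simpa using hl
    have := esc_lam hd (by linarith) m hm
    have h0 : log⁺ (‖cc d lam m‖⁻¹) = 0 := by
      rw [posLog_eq_zero_iff, abs_of_nonneg (by positivity)]
      exact inv_le_one_of_one_le₀ (by linarith)
    rw [h0, zero_mul]
  have hmeas : AEStronglyMeasurable (fun lam : ℂ => log⁺ (‖cc d lam m‖⁻¹) * dens lam) := by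
    apply Measurable.aestronglyMeasurable
    refine Measurable.mul ?_ dens_cont.measurable
    exact continuous_posLog.measurable.comp (cc_cont d m).norm.measurable.inv
  have hball := (Metric.isOpen_ball (x := (0:ℂ)) (ε := 3)).measurableSet
  have hbd : ∀ᵐ lam : ℂ ∂(volume.restrict (Metric.ball 0 3)),
      log⁺ (‖cc d lam m‖⁻¹) ≤ C1 * m + WW d m lam := by
    rw [ae_restrict_iff' hball]
    filter_upwards [cc_ae hd] with lam h1 h2
    exact hp lam m hm (by simpa using h2) fun k hk _ => h1 k hk
  have hci : ∀ c : ℝ, IntegrableOn (fun _ : ℂ => c) (Metric.ball (0 : ℂ) 3) := fun c =>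
    integrableOn_const hfin
  have hmajI : IntegrableOn (fun lam => C1 * m + WW d m lam) (Metric.ball (0 : ℂ) 3) :=
    (hci _).add (hW m).1
  have hIon : IntegrableOn (fun lam : ℂ => log⁺ (‖cc d lam m‖⁻¹) * dens lam)
      (Metric.ball 0 3) := by
    refine Integrable.mono' (hmajI.mul_const π⁻¹) hmeas.restrict ?_
    filter_upwards [hbd] with lam h
    rw [Real.norm_of_nonneg (mul_nonneg posLog_nonneg (dens_nonneg _))]
    exact mul_le_mul h (dens_le _) (dens_nonneg _) (posLog_nonneg.trans h)
  refine ⟨(integrableOn_iff_integrable_of_support_subset ?_).1 hIon, ?_⟩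
  · intro lam h
    by_contra h'
    exact h (hzero lam h')
  rw [← setIntegral_eq_integral_of_forall_compl_eq_zero hzero, ← integral_const_mul]
  have hdI : IntegrableOn dens (Metric.ball (0 : ℂ) 3) := by
    refine Integrable.mono' (hci π⁻¹) dens_cont.aestronglyMeasurable ?_
    exact Filter.Eventually.of_forall fun z => by
      rw [Real.norm_of_nonneg (dens_nonneg _)]; exact dens_le z
  set g2 : ℂ → ℝ := (B m).indicator (fun lam => ((d : ℝ) - 1) * π⁻¹ * (C1 * m)) with hg2
  have hg2I : IntegrableOn g2 (Metric.ball (0 : ℂ) 3) := (hci _).indicator (hBm m)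
  have hWI := ((hW m).1.const_mul (((d : ℝ) - 1) * π⁻¹))
  have hmaj : ∀ᵐ lam : ℂ ∂(volume.restrict (Metric.ball 0 3)),
      ((d : ℝ) - 1) * (log⁺ (‖cc d lam m‖⁻¹) * dens lam) ≤
      2.2 * m * Real.log d * dens lam + (g2 lam + ((d : ℝ) - 1) * π⁻¹ * WW d m lam) := by
    filter_upwards [hbd, ae_restrict_mem hball, ae_restrict_of_ae (cc_ae hd)] with lam h hmem hne
    have hWn := WW_nonneg d m lam
    have hdn := dens_nonneg lam
    by_cases hlb : lam ∈ B m
    · rw [hg2, Set.indicator_of_mem hlb]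
      have := mul_le_mul h (dens_le lam) (dens_nonneg _) (posLog_nonneg.trans h)
      have h2 := mul_le_mul_of_nonneg_left this hd10.le
      have h3 : 0 ≤ 2.2 * m * Real.log d * dens lam := by positivity
      linarith
    · rw [hg2, Set.indicator_of_notMem hlb]
      have h1 : 1 ≤ L ^ m * ‖cc d lam m‖ ^ (d - 1) := by
        by_contra hh
        exact hlb ⟨hmem, not_le.1 hh⟩
      have hpos : 0 < ‖cc d lam m‖ := norm_pos_iff.2 (hne m hm)
      have h2 := Real.log_nonneg h1
      rw [Real.log_mul (by positivity) (by positivity), Real.log_pow, Real.log_pow, hL,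
        Real.log_exp, Nat.cast_sub hd.le, Nat.cast_one] at h2
      have h3 : ((d : ℝ) - 1) * log⁺ (‖cc d lam m‖⁻¹) ≤ 2.2 * m * Real.log d := by
        rw [show log⁺ (‖cc d lam m‖⁻¹) = max 0 (Real.log (‖cc d lam m‖⁻¹)) from rfl,
          Real.log_inv, mul_max_of_nonneg _ _ hd10.le]
        apply max_le
        · rw [mul_zero]; positivity
        · nlinarith
      have h4 := mul_le_mul_of_nonneg_right h3 hdn
      have h5 : 0 ≤ ((d : ℝ) - 1) * π⁻¹ * WW d m lam := by positivity
      linarith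
  have hle := integral_mono_ae (hIon.const_mul ((d : ℝ) - 1))
    ((hdI.const_mul (2.2 * m * Real.log d)).add (hg2I.add hWI)) hmaj
  refine hle.trans ?_
  rw [integral_add' (hdI.const_mul (2.2 * m * Real.log d)) (hg2I.add hWI),
    integral_add' hg2I hWI, integral_const_mul, integral_const_mul, dens_ball]
  have hg2v : ∫ lam in Metric.ball (0 : ℂ) 3, g2 lam =
      volume.real (B m) * (((d : ℝ) - 1) * π⁻¹ * (C1 * m)) := by
    rw [hg2, setIntegral_indicator (hBm m), Set.inter_eq_self_of_subset_right
      (show B m ⊆ Metric.ball 0 3 from Set.inter_subset_left), setIntegral_const, smul_eq_mul]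
  rw [hg2v]
  have h6 : ((d : ℝ) - 1) * π⁻¹ * ∫ a in Metric.ball (0 : ℂ) 3, WW d m a ≤
      ((d : ℝ) - 1) * π⁻¹ * C2 := by
    gcongr
    exact (hW m).2
  have h7 : volume.real (B m) * (((d : ℝ) - 1) * π⁻¹ * (C1 * m)) ≤ 0.02 * m * Real.log d +
      ((d : ℝ) - 1) * C1 * π⁻¹ * m0 * (9 * π) := by
    have hpos : 0 ≤ ((d : ℝ) - 1) * C1 * π⁻¹ := by positivity
    rcases le_total m0 m with hmm | hmm
    · have := mul_le_mul_of_nonneg_right (hm0 m hmm) (Nat.cast_nonneg (α := ℝ) m)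
      have : 0 ≤ ((d : ℝ) - 1) * C1 * π⁻¹ * m0 * (9 * π) := by positivity
      linarith
    · have h8 : volume.real (B m) * (m : ℝ) ≤ (9 * π) * m0 := by
        gcongr
        exact hBle m
      have := mul_le_mul_of_nonneg_left h8 hpos
      have : 0 ≤ 0.02 * m * Real.log d := by positivity
      linarith
  linarith

lemma param_deriv (F F' : ℝ → ℝ → ℝ) (hF : Continuous (Function.uncurry F))
    (hF' : Continuous (Function.uncurry F')) (h : ∀ r t, HasDerivAt (fun x => F x t) (F' r t) r)
    (a b r : ℝ) : HasDerivAt (fun x => ∫ t in a..b, F x t) (∫ t in a..b, F' r t) r := by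
  obtain ⟨M, hM⟩ := ((isCompact_Icc (a := r - 1) (b := r + 1)).prod
    (isCompact_uIcc (a := a) (b := b))).exists_bound_of_continuousOn hF'.continuousOn
  have hc : ∀ x, Continuous (F x) := fun x => hF.comp (by fun_prop : Continuous fun t => (x, t))
  have hc' : ∀ x, Continuous (F' x) := fun x => hF'.comp (by fun_prop : Continuous fun t => (x, t))
  refine (intervalIntegral.hasDerivAt_integral_of_dominated_loc_of_deriv_le
    (s := Set.Icc (r - 1) (r + 1)) (bound := fun _ => M)
    (Icc_mem_nhds (by linarith) (by linarith)) ?_ ?_ ?_ ?_ ?_ ?_).2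
  · exact Filter.Eventually.of_forall fun x => (hc x).aestronglyMeasurable
  · exact (hc r).intervalIntegrable _ _
  · exact (hc' r).aestronglyMeasurable
  · exact Filter.Eventually.of_forall fun t ht x hx =>
      hM (x, t) ⟨hx, Set.uIoc_subset_uIcc ht⟩
  · exact intervalIntegrable_const
  · exact Filter.Eventually.of_forall fun t ht x hx => h x t

noncomputable def uvec (t : ℝ) : ℂ := (Real.cos t : ℂ) + (Real.sin t : ℂ) * Complex.I

lemma uvec_cont : Continuous uvec := by unfold uvec; fun_prop

lemma uvec_norm (t : ℝ) : ‖uvec t‖ = 1 := by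
  unfold uvec
  rw [Complex.ofReal_cos, Complex.ofReal_sin, ← Complex.exp_mul_I, Complex.norm_exp_ofReal_mul_I]

lemma uvec_deriv (t : ℝ) : HasDerivAt uvec (Complex.I * uvec t) t := by
  unfold uvec
  have h1 := (Real.hasDerivAt_cos t).ofReal_comp
  have h2 := ((Real.hasDerivAt_sin t).ofReal_comp).mul_const Complex.I
  refine (h1.add h2).congr_deriv ?_
  push_cast
  linear_combination -(Complex.sin t) * Complex.I_sq

lemma lap_eq (φ : ℂ → ℝ) (z : ℂ) :
    lap φ z = fderiv ℝ (fderiv ℝ φ) z 1 1 + fderiv ℝ (fderiv ℝ φ) z Complex.I Complex.I := by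
  unfold lap
  simp [iteratedFDeriv_two_apply]

lemma lap_rot (φ : ℂ → ℝ) (z : ℂ) (t : ℝ) :
    fderiv ℝ (fderiv ℝ φ) z (uvec t) (uvec t) +
      fderiv ℝ (fderiv ℝ φ) z (Complex.I * uvec t) (Complex.I * uvec t) = lap φ z := by
  rw [lap_eq]
  generalize fderiv ℝ (fderiv ℝ φ) z = D
  have h1 : uvec t = (Real.cos t) • (1 : ℂ) + (Real.sin t) • Complex.I := by
    simp [uvec]
  have h2 : Complex.I * uvec t = (-Real.sin t) • (1 : ℂ) + (Real.cos t) • Complex.I := by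
    simp only [uvec, Complex.real_smul]
    push_cast
    linear_combination (Complex.sin t) * Complex.I_sq
  rw [h2, h1]
  simp only [map_add, map_smul, add_apply, smul_apply, smul_eq_mul]
  linear_combination (D 1 1 + D Complex.I Complex.I) * Real.sin_sq_add_cos_sq t

section
variable (φ : ℂ → ℝ) (a : ℂ)

noncomputable def Mav (r : ℝ) : ℝ := ∫ t in (-π)..π, φ (a + r * uvec t)
noncomputable def Nav (r : ℝ) : ℝ := ∫ t in (-π)..π, fderiv ℝ φ (a + r * uvec t) (uvec t)
noncomputable def Lav (r : ℝ) : ℝ := ∫ t in (-π)..π, lap φ (a + r * uvec t)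
noncomputable def Nav' (r : ℝ) : ℝ :=
  ∫ t in (-π)..π, fderiv ℝ (fderiv ℝ φ) (a + r * uvec t) (uvec t) (uvec t)

variable {φ}

lemma line_deriv (r : ℝ) (t : ℝ) :
    HasDerivAt (fun x : ℝ => a + x * uvec t) (uvec t) r := by
  have := (((hasDerivAt_id r).ofReal_comp).mul_const (uvec t)).const_add a
  simpa using this

lemma circ_deriv (r : ℝ) (t : ℝ) :
    HasDerivAt (fun t : ℝ => a + r * uvec t) (r * (Complex.I * uvec t)) t :=
  ((uvec_deriv t).const_mul (r : ℂ)).const_add a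

lemma d1_diff (hφ : ContDiff ℝ 2 φ) : ContDiff ℝ 1 (fderiv ℝ φ) :=
  hφ.fderiv_right (m := 1) (by norm_num)

lemma d2_cont (hφ : ContDiff ℝ 2 φ) : Continuous (fderiv ℝ (fderiv ℝ φ)) :=
  (d1_diff hφ).continuous_fderiv (by norm_num)

lemma lap_cont (hφ : ContDiff ℝ 2 φ) : Continuous (lap φ) := by
  have := d2_cont hφ
  rw [show lap φ = fun z => fderiv ℝ (fderiv ℝ φ) z 1 1 +
    fderiv ℝ (fderiv ℝ φ) z Complex.I Complex.I from funext (lap_eq φ)]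
  fun_prop

lemma Mav_deriv (hφ : ContDiff ℝ 2 φ) (r : ℝ) : HasDerivAt (Mav φ a) (Nav φ a r) r := by
  have hc := uvec_cont
  have h1 := hφ.continuous
  have h2 := (d1_diff hφ).continuous
  apply param_deriv (fun r t => φ (a + r * uvec t)) (fun r t => fderiv ℝ φ (a + r * uvec t) (uvec t))
  · unfold Function.uncurry
    fun_prop
  · unfold Function.uncurry
    fun_prop
  · intro r t
    exact ((hφ.differentiable (by norm_num)) _).hasFDerivAt.comp_hasDerivAt r (line_deriv a r t)

lemma Nav_deriv (hφ : ContDiff ℝ 2 φ) (r : ℝ) : HasDerivAt (Nav φ a) (Nav' φ a r) r := by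
  have hc := uvec_cont
  have h2 := (d1_diff hφ).continuous
  have h3 := d2_cont hφ
  apply param_deriv (fun r t => fderiv ℝ φ (a + r * uvec t) (uvec t))
    (fun r t => fderiv ℝ (fderiv ℝ φ) (a + r * uvec t) (uvec t) (uvec t))
  · unfold Function.uncurry
    fun_prop
  · unfold Function.uncurry
    fun_prop
  · intro r t
    have := (((d1_diff hφ).differentiable (by norm_num)) _).hasFDerivAt.comp_hasDerivAt r
      (line_deriv a r t)
    simpa using this.clm_apply (hasDerivAt_const r (uvec t))

lemma Nav_LL (hφ : ContDiff ℝ 2 φ) (r : ℝ) : Nav φ a r + r * Nav' φ a r = r * Lav φ a r := by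
  have hc := uvec_cont
  have h2 := (d1_diff hφ).continuous
  have h3 := d2_cont hφ
  have h4 := lap_cont hφ
  have hd : ∀ t, HasDerivAt (fun t => fderiv ℝ φ (a + r * uvec t) (Complex.I * uvec t))
      (r * fderiv ℝ (fderiv ℝ φ) (a + r * uvec t) (Complex.I * uvec t) (Complex.I * uvec t)
        - fderiv ℝ φ (a + r * uvec t) (uvec t)) t := by
    intro t
    have := (((d1_diff hφ).differentiable (by norm_num)) _).hasFDerivAt.comp_hasDerivAt t
      (circ_deriv a r t)
    refine (this.clm_apply ((uvec_deriv t).const_mul Complex.I)).congr_deriv ?_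
    have e1 : Complex.I * (Complex.I * uvec t) = - uvec t := by
      linear_combination (uvec t) * Complex.I_sq
    have e2 : (r : ℂ) * (Complex.I * uvec t) = r • (Complex.I * uvec t) := by simp
    rw [e1, e2, map_neg, map_smul, smul_apply, smul_eq_mul]
    rfl
  have h0 := intervalIntegral.integral_eq_sub_of_hasDerivAt (a := -π) (b := π) (fun t _ => hd t)
    (Continuous.intervalIntegrable (by fun_prop) _ _)
  have hee : uvec (-π) = uvec π := by simp [uvec]
  rw [hee, sub_self] at h0
  rw [Nav, Nav', Lav, ← intervalIntegral.integral_const_mul, ← intervalIntegral.integral_const_mul,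
    ← intervalIntegral.integral_add (Continuous.intervalIntegrable (by fun_prop) _ _)
     (Continuous.intervalIntegrable (by fun_prop) _ _), ← add_zero (∫ t in (-π)..π, _), ← h0,
    ← intervalIntegral.integral_add (Continuous.intervalIntegrable (by fun_prop) _ _)
     (Continuous.intervalIntegrable (by fun_prop) _ _)]
  congr 1
  ext t
  rw [← lap_rot φ _ t]
  ring

lemma HH_deriv (hφ : ContDiff ℝ 2 φ) (r : ℝ) (hr : 0 < r) :
    HasDerivAt (fun r => r * Real.log r * Nav φ a r - Mav φ a r) (r * Real.log r * Lav φ a r) r := by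
  have h := ((Real.hasDerivAt_mul_log hr.ne').mul (Nav_deriv a hφ r)).sub (Mav_deriv a hφ r)
  refine h.congr_deriv ?_
  linear_combination Real.log r * Nav_LL a hφ r

lemma HH_cont (hφ : ContDiff ℝ 2 φ) :
    Continuous (fun r => r * Real.log r * Nav φ a r - Mav φ a r) := by
  have h1 : Continuous (Nav φ a) := continuous_iff_continuousAt.2 fun r =>
    (Nav_deriv a hφ r).continuousAt
  have h2 : Continuous (Mav φ a) := continuous_iff_continuousAt.2 fun r =>
    (Mav_deriv a hφ r).continuousAt
  exact (Real.continuous_mul_log.mul h1).sub h2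

end

lemma inf_bd {φ : ℂ → ℝ} {φinf : ℝ}
    (hχ : ContDiffAt ℝ 2 (fun w : ℂ => if w = 0 then φinf else φ w⁻¹) 0) :
    ∃ K R : ℝ, 0 ≤ K ∧ 0 < R ∧ (∀ z, R < ‖z‖ → |φ z - φinf| ≤ K / ‖z‖) ∧
      ∀ ρ, R ≤ ρ → ∀ z, ρ < ‖z‖ → ‖fderiv ℝ φ z‖ ≤ K / ρ ^ 2 := by
  obtain ⟨K, t, ht, hK⟩ := (hχ.of_le (by norm_num : (1 : WithTop ℕ∞) ≤ 2)).exists_lipschitzOnWith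
  obtain ⟨δ, hδ, hball⟩ := Metric.mem_nhds_iff.1 ht
  have hin : ∀ z : ℂ, δ⁻¹ < ‖z‖ → z⁻¹ ∈ t := by
    intro z hz
    apply hball
    rw [mem_ball_zero_iff, norm_inv]
    exact inv_lt_of_inv_lt₀ hδ hz
  have hne : ∀ z : ℂ, δ⁻¹ < ‖z‖ → z ≠ 0 := by
    rintro z hz rfl
    have : 0 < δ⁻¹ := by positivity
    simp at hz
    linarith
  refine ⟨K, δ⁻¹, K.2, by positivity, ?_, ?_⟩
  · intro z hz
    have := hK.dist_le_mul _ (hin z hz) 0 (hball (Metric.mem_ball_self hδ))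
    simpa [hne z hz, Real.dist_eq, div_eq_mul_inv] using this
  · intro ρ hρ z hz
    have hρ0 : 0 < ρ := lt_of_lt_of_le (by positivity) hρ
    have hlip : LipschitzOnWith (K / (Real.toNNReal ρ) ^ 2) φ {w : ℂ | ρ < ‖w‖} := by
      apply LipschitzOnWith.of_dist_le_mul
      intro x hx y hy
      have hx' : ρ < ‖x‖ := hx
      have hy' : ρ < ‖y‖ := hy
      have hx0 := hne x (hρ.trans_lt hx')
      have hy0 := hne y (hρ.trans_lt hy')
      have := hK.dist_le_mul _ (hin x (hρ.trans_lt hx')) _ (hin y (hρ.trans_lt hy'))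
      simp only [inv_eq_zero, hx0, hy0, if_false, inv_inv] at this
      refine this.trans ?_
      rw [dist_eq_norm, dist_eq_norm, inv_sub_inv hx0 hy0, norm_div, norm_mul, norm_sub_rev y x]
      push_cast
      rw [Real.coe_toNNReal _ hρ0.le, div_mul_eq_mul_div, mul_div_assoc]
      gcongr
      rw [sq]
      gcongr
    have hopen : {w : ℂ | ρ < ‖w‖} ∈ nhds z :=
      (isOpen_lt continuous_const continuous_norm).mem_nhds hz
    have := norm_fderiv_le_of_lipschitzOn ℝ hopen hlip
    simpa [hρ0.le] using this

lemma HH_lim {φ : ℂ → ℝ} {φinf : ℝ} (a : ℂ)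
    (hχ : ContDiffAt ℝ 2 (fun w : ℂ => if w = 0 then φinf else φ w⁻¹) 0)
    (hφ : ContDiff ℝ 2 φ) :
    Filter.Tendsto (fun r => r * Real.log r * Nav φ a r - Mav φ a r) Filter.atTop
      (nhds (0 - 2 * π * φinf)) := by
  obtain ⟨K, R, hK, hR, h1, h2⟩ := inf_bd hχ
  have hz : ∀ r : ℝ, 2 * ‖a‖ + 2 * R < r → ∀ t, r / 2 < ‖a + r * uvec t‖ := by
    intro r hr t
    have h0 := norm_nonneg a
    have : ‖(r : ℂ) * uvec t‖ = r := by
      rw [norm_mul, uvec_norm, mul_one, Complex.norm_real, Real.norm_of_nonneg (by linarith)]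
    have h3 := norm_sub_le (a + r * uvec t) a
    rw [add_sub_cancel_left, this] at h3
    linarith
  have hcu := uvec_cont
  have hinv : Filter.Tendsto (fun r : ℝ => r⁻¹) Filter.atTop (nhds 0) := tendsto_inv_atTop_zero
  refine Filter.Tendsto.sub ?_ ?_
  · have hlim : Filter.Tendsto (fun r : ℝ => 8 * π * K * (Real.log r / r)) Filter.atTop
        (nhds 0) := by
      have := (Real.isLittleO_log_id_atTop.tendsto_div_nhds_zero).const_mul (8 * π * K)
      simpa using this
    refine squeeze_zero_norm' ?_ hlim
    filter_upwards [Filter.eventually_gt_atTop (2 * ‖a‖ + 2 * R), Filter.eventually_ge_atTop 1]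
      with r hr hr1
    have hN : ‖Nav φ a r‖ ≤ K / (r / 2) ^ 2 * |π - -π| := by
      apply intervalIntegral.norm_integral_le_of_norm_le_const
      intro t _
      refine (ContinuousLinearMap.le_opNorm _ _).trans ?_
      rw [uvec_norm, mul_one]
      exact h2 (r / 2) (by linarith [norm_nonneg a]) _ (hz r hr t)
    rw [norm_mul, norm_mul, Real.norm_of_nonneg (Real.log_nonneg hr1),
      Real.norm_of_nonneg (by linarith : (0 : ℝ) ≤ r)]
    have hl := Real.log_nonneg hr1
    rw [abs_of_pos (by linarith [pi_pos])] at hN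
    calc r * Real.log r * ‖Nav φ a r‖ ≤ r * Real.log r * (K / (r / 2) ^ 2 * (π - -π)) := by
          gcongr
      _ = _ := by field_simp; ring
  · rw [← tendsto_sub_nhds_zero_iff]
    have hlim : Filter.Tendsto (fun r : ℝ => 4 * π * K * r⁻¹) Filter.atTop (nhds 0) := by
      simpa using hinv.const_mul (4 * π * K)
    refine squeeze_zero_norm' ?_ hlim
    filter_upwards [Filter.eventually_gt_atTop (2 * ‖a‖ + 2 * R), Filter.eventually_ge_atTop 1]
      with r hr hr1
    have hc := hφ.continuous
    have e : Mav φ a r - 2 * π * φinf = ∫ t in (-π)..π, (φ (a + r * uvec t) - φinf) := by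
      rw [intervalIntegral.integral_sub (Continuous.intervalIntegrable (by fun_prop) _ _)
        (by simp), Mav, intervalIntegral.integral_const, smul_eq_mul]
      ring
    rw [e]
    have hM : ‖∫ t in (-π)..π, (φ (a + r * uvec t) - φinf)‖ ≤ K / (r / 2) * |π - -π| := by
      apply intervalIntegral.norm_integral_le_of_norm_le_const
      intro t _
      have h3 := hz r hr t
      refine (h1 _ (by linarith [norm_nonneg a])).trans ?_
      gcongr
    rw [abs_of_pos (by linarith [pi_pos])] at hM
    refine hM.trans (le_of_eq ?_)
    field_simp
    ring

lemma dens_three {z : ℂ} : (1 + ‖z‖) * dens z ≤ 2 * (1 + ‖z‖ ^ 2) ^ (-(3 : ℝ) / 2) := by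
  have h0 := norm_nonneg z
  have hp : 0 < 1 + ‖z‖ ^ 2 := by positivity
  have h1 : 1 + ‖z‖ ≤ 2 * (1 + ‖z‖ ^ 2) ^ ((1 : ℝ) / 2) := by
    rw [← Real.sqrt_eq_rpow]
    have : 1 ≤ √(1 + ‖z‖ ^ 2) := Real.one_le_sqrt.2 (by nlinarith)
    have : ‖z‖ ≤ √(1 + ‖z‖ ^ 2) := Real.le_sqrt_of_sq_le (by linarith)
    linarith
  have h2 : dens z ≤ (1 + ‖z‖ ^ 2) ^ (-2 : ℝ) := by
    unfold dens
    rw [Real.rpow_neg hp.le, Real.rpow_two]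
    apply inv_anti₀ (by positivity)
    have : 0 < (1 + ‖z‖ ^ 2) ^ 2 := by positivity
    nlinarith [pi_gt_three]
  calc (1 + ‖z‖) * dens z ≤ (2 * (1 + ‖z‖ ^ 2) ^ ((1 : ℝ) / 2)) * (1 + ‖z‖ ^ 2) ^ (-2 : ℝ) := by
        gcongr
        exact dens_nonneg z
    _ = _ := by
        rw [mul_assoc, ← Real.rpow_add hp]
        norm_num

lemma three_int : Integrable (fun z : ℂ => (1 + ‖z‖ ^ 2) ^ (-(3 : ℝ) / 2)) := by
  apply integrable_rpow_neg_one_add_norm_sq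
  rw [Complex.finrank_real_complex]
  norm_num

lemma dens_int : Integrable dens := by
  refine Integrable.mono' (three_int.const_mul 2) dens_cont.aestronglyMeasurable ?_
  refine Filter.Eventually.of_forall fun z => ?_
  rw [Real.norm_of_nonneg (dens_nonneg _)]
  refine le_trans ?_ (dens_three (z := z))
  nlinarith [dens_nonneg z, norm_nonneg z, mul_nonneg (norm_nonneg z) (dens_nonneg z)]

lemma log_meas (a : ℂ) : Measurable fun z : ℂ => Real.log ‖z - a‖ := by fun_prop

lemma log_dens_int (a : ℂ) : Integrable (fun z : ℂ => Real.log ‖z - a‖ * dens z) := by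
  obtain ⟨M, hM, h⟩ := int_inv (‖a‖ + 1)
  have hI1 : Integrable ((Metric.ball (0 : ℂ) (‖a‖ + 1)).indicator fun z => ‖z - a‖⁻¹) :=
    (h a).1.integrable_indicator Metric.isOpen_ball.measurableSet
  have hI2 := three_int.const_mul (2 * (1 + ‖a‖ + 1))
  refine Integrable.mono' (hI1.add hI2)
    ((log_meas a).mul dens_cont.measurable).aestronglyMeasurable ?_
  refine Filter.Eventually.of_forall fun z => ?_
  have hd := dens_nonneg z
  have hd1 : dens z ≤ 1 := (dens_le z).trans (inv_le_one_of_one_le₀ (by linarith [pi_gt_three]))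
  have h3 := dens_three (z := z)
  have hb : ‖z - a‖ ≤ ‖z‖ + ‖a‖ := norm_sub_le _ _
  rw [norm_mul, Real.norm_of_nonneg hd, Real.norm_eq_abs]
  simp only [Pi.add_apply]
  have hn := norm_nonneg a
  have hz := norm_nonneg z
  have hx := norm_nonneg (z - a)
  set x := ‖z - a‖
  have hlog : |Real.log x| ≤ x + x⁻¹ := by
    rcases hx.eq_or_lt with h0 | h0
    · rw [← h0]; simp
    · have h1 := Real.log_le_sub_one_of_pos h0
      have h2 := Real.log_le_sub_one_of_pos (inv_pos.2 h0)
      rw [Real.log_inv] at h2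
      have := inv_pos.2 h0
      rw [abs_le]
      constructor <;> linarith
  have h4 : x * dens z ≤ (1 + ‖a‖) * (2 * (1 + ‖z‖ ^ 2) ^ (-(3 : ℝ) / 2)) := by
    calc x * dens z ≤ ((1 + ‖a‖) * (1 + ‖z‖)) * dens z := by
          gcongr
          nlinarith
      _ = (1 + ‖a‖) * ((1 + ‖z‖) * dens z) := by ring
      _ ≤ _ := by gcongr
  have h5 : x⁻¹ * dens z ≤ (Metric.ball (0 : ℂ) (‖a‖ + 1)).indicator (fun z => ‖z - a‖⁻¹) z +
      2 * (1 + ‖z‖ ^ 2) ^ (-(3 : ℝ) / 2) := by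
    by_cases hzb : z ∈ Metric.ball (0 : ℂ) (‖a‖ + 1)
    · rw [Set.indicator_of_mem hzb]
      have : x⁻¹ * dens z ≤ x⁻¹ * 1 := by gcongr
      have : 0 ≤ 2 * (1 + ‖z‖ ^ 2) ^ (-(3 : ℝ) / 2) := by positivity
      linarith
    · rw [Set.indicator_of_notMem hzb]
      have h6 : ‖a‖ + 1 ≤ ‖z‖ := by simpa using hzb
      have h7 : 1 ≤ x := by
        have := norm_sub_norm_le z a
        linarith
      have h8 : x⁻¹ ≤ 1 := inv_le_one_of_one_le₀ h7
      nlinarith [mul_nonneg hz hd]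
  have h9 := mul_le_mul_of_nonneg_right hlog hd
  linarith

lemma lap_bd {φ : ℂ → ℝ} {K : ℝ} (hK : ∀ lam : ℂ, |(1 + ‖lam‖ ^ 2) ^ 2 * lap φ lam / 2| ≤ K)
    (z : ℂ) : |lap φ z| ≤ 2 * π * K * dens z := by
  have h := hK z
  have hp : 0 < (1 + ‖z‖ ^ 2) ^ 2 := by positivity
  rw [abs_div, abs_mul, abs_of_pos hp, abs_two] at h
  unfold dens
  rw [show 2 * π * K * (π * (1 + ‖z‖ ^ 2) ^ 2)⁻¹ = 2 * K / (1 + ‖z‖ ^ 2) ^ 2 by field_simp,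
    le_div_iff₀ hp]
  rw [div_le_iff₀ (by norm_num)] at h
  linarith

lemma lap_int {φ : ℂ → ℝ} {K : ℝ} (hφ : ContDiff ℝ 2 φ)
    (hK : ∀ lam : ℂ, |(1 + ‖lam‖ ^ 2) ^ 2 * lap φ lam / 2| ≤ K) {h : ℂ → ℝ}
    (hh : AEStronglyMeasurable h) (hi : Integrable (fun z => h z * dens z)) :
    Integrable (fun z => h z * lap φ z) := by
  refine Integrable.mono' (hi.norm.const_mul (2 * π * K))
    (hh.mul (lap_cont hφ).aestronglyMeasurable) ?_
  refine Filter.Eventually.of_forall fun z => ?_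
  rw [norm_mul, norm_mul, Real.norm_of_nonneg (dens_nonneg z), Real.norm_eq_abs (lap φ z)]
  have := mul_le_mul_of_nonneg_left (lap_bd hK z) (norm_nonneg (h z))
  linarith

lemma polar_int {f : ℂ → ℝ} (hm : Measurable f) (hf : Integrable f) :
    IntegrableOn (fun p : ℝ × ℝ => p.1 • f (Complex.polarCoord.symm p)) polarCoord.target := by
  have hc : Measurable fun p : ℝ × ℝ => Complex.polarCoord.symm p := by
    simp_rw [Complex.polarCoord_symm_apply]
    fun_prop
  refine ⟨(measurable_fst.smul (hm.comp hc)).aestronglyMeasurable, ?_⟩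
  have h1 := Complex.lintegral_comp_polarCoord_symm (fun z => ‖f z‖ₑ)
  have h2 := hf.2
  rw [HasFiniteIntegral, ← h1] at h2
  refine lt_of_le_of_lt (le_of_eq ?_) h2
  apply setLIntegral_congr_fun polarCoord.open_target.measurableSet
  intro p hp
  have : 0 < p.1 := hp.1
  simp only [smul_eq_mul]
  rw [enorm_mul, Real.enorm_of_nonneg this.le]

lemma green {φ : ℂ → ℝ} {φinf K : ℝ} (hφ : ContDiff ℝ 2 φ)
    (hχ : ContDiffAt ℝ 2 (fun w : ℂ => if w = 0 then φinf else φ w⁻¹) 0)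
    (hK : ∀ lam : ℂ, |(1 + ‖lam‖ ^ 2) ^ 2 * lap φ lam / 2| ≤ K) (a : ℂ) :
    Integrable (fun z => Real.log ‖z - a‖ * lap φ z) ∧
    ∫ z, Real.log ‖z - a‖ * lap φ z = 2 * π * (φ a - φinf) := by
  have hI := lap_int hφ hK (log_meas a).aestronglyMeasurable (log_dens_int a)
  refine ⟨hI, ?_⟩
  have hI2 := hI.comp_add_left a
  rw [← integral_add_left_eq_self _ a, ← Complex.integral_comp_polarCoord_symm]
  have hlm := (lap_cont hφ).measurable
  have hP := polar_int (by fun_prop) hI2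
  rw [show polarCoord.target = Set.Ioi (0 : ℝ) ×ˢ Set.Ioo (-π) π from rfl] at hP ⊢
  rw [Measure.volume_eq_prod] at hP ⊢
  rw [setIntegral_prod _ hP]
  have hinner : ∀ r ∈ Set.Ioi (0 : ℝ), ∫ t in Set.Ioo (-π) π, r • (Real.log
      ‖a + Complex.polarCoord.symm (r, t) - a‖ * lap φ (a + Complex.polarCoord.symm (r, t))) =
      r * Real.log r * Lav φ a r := by
    intro r hr
    rw [Lav, intervalIntegral.integral_of_le (by linarith [pi_pos]), integral_Ioc_eq_integral_Ioo,
      ← integral_const_mul]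
    congr 1
    ext t
    rw [add_sub_cancel_left, Complex.norm_polarCoord_symm, abs_of_pos (show 0 < (r, t).1 from hr),
      Complex.polarCoord_symm_apply, smul_eq_mul]
    simp only [uvec]
    ring
  have hintg : IntegrableOn (fun r => r * Real.log r * Lav φ a r) (Set.Ioi 0) := by
    rw [IntegrableOn, ← Measure.prod_restrict] at hP
    refine IntegrableOn.congr_fun hP.integral_prod_left ?_ measurableSet_Ioi
    intro r hr
    exact hinner r hr
  rw [setIntegral_congr_fun measurableSet_Ioi hinner,
    integral_Ioi_of_hasDerivAt_of_tendsto (HH_cont a hφ).continuousWithinAt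
      (fun r hr => HH_deriv a hφ r hr) hintg (HH_lim a hχ hφ)]
  simp [Mav]
  ring

lemma green_multiset {φ : ℂ → ℝ} {φinf K : ℝ} (hφ : ContDiff ℝ 2 φ)
    (hχ : ContDiffAt ℝ 2 (fun w : ℂ => if w = 0 then φinf else φ w⁻¹) 0)
    (hK : ∀ lam : ℂ, |(1 + ‖lam‖ ^ 2) ^ 2 * lap φ lam / 2| ≤ K) (s : Multiset ℂ) :
    Integrable (fun z => (s.map fun a => Real.log ‖z - a‖).sum * lap φ z) ∧
    ∫ z, (s.map fun a => Real.log ‖z - a‖).sum * lap φ z =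
      2 * π * ((s.map φ).sum - s.card * φinf) := by
  induction s using Multiset.induction_on with
  | empty => simp
  | cons a s ih =>
    simp only [Multiset.map_cons, Multiset.sum_cons, Multiset.card_cons, add_mul]
    have hg := green hφ hχ hK a
    refine ⟨hg.1.add ih.1, ?_⟩
    rw [integral_add hg.1 ih.1, hg.2, ih.2]
    push_cast
    ring

lemma log_prod_multiset (s : Multiset ℂ) (z : ℂ) (h : ∀ a ∈ s, z ≠ a) :
    Real.log ‖(s.map fun a => z - a).prod‖ = (s.map fun a => Real.log ‖z - a‖).sum := by
  induction s using Multiset.induction_on with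
  | empty => simp
  | cons a s ih =>
    simp only [Multiset.map_cons, Multiset.sum_cons, Multiset.prod_cons, norm_mul]
    have h1 : ‖z - a‖ ≠ 0 := norm_ne_zero_iff.2 (sub_ne_zero.2 (h a (Multiset.mem_cons_self a s)))
    have h2 : ‖(s.map fun a => z - a).prod‖ ≠ 0 := by
      rw [norm_ne_zero_iff]
      apply Multiset.prod_ne_zero
      intro h0
      obtain ⟨b, hb, hb'⟩ := Multiset.mem_map.1 h0
      exact h b (Multiset.mem_cons_of_mem hb) (sub_eq_zero.1 hb')
    rw [Real.log_mul h1 h2, ih fun b hb => h b (Multiset.mem_cons_of_mem hb)]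

lemma green_F {d : ℕ} (hd : 1 < d) {φ : ℂ → ℝ} {φinf K : ℝ} (hφ : ContDiff ℝ 2 φ)
    (hχ : ContDiffAt ℝ 2 (fun w : ℂ => if w = 0 then φinf else φ w⁻¹) 0)
    (hK : ∀ lam : ℂ, |(1 + ‖lam‖ ^ 2) ^ 2 * lap φ lam / 2| ≤ K) {m : ℕ} (hm : 1 ≤ m) :
    Integrable (fun z => Real.log ‖cc d z m‖ * lap φ z) ∧
    ∫ z, Real.log ‖cc d z m‖ * lap φ z =
      2 * π * (((Fp d m).roots.map φ).sum - (d : ℝ) ^ (m - 1) * φinf) := by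
  have h := green_multiset hφ hχ hK (Fp d m).roots
  rw [Fp_card_roots hd hm] at h
  push_cast at h
  have hmon : (Fp d m).Monic := by
    obtain ⟨j, rfl⟩ := Nat.exists_eq_add_of_le' hm
    exact (Fp_monic_deg hd j).1
  have hae : (fun z => ((Fp d m).roots.map fun a => Real.log ‖z - a‖).sum * lap φ z) =ᵐ[volume]
      (fun z => Real.log ‖cc d z m‖ * lap φ z) := by
    filter_upwards [cc_ae hd] with z hz
    rw [← log_prod_multiset, ← Fp_eval,
      (IsAlgClosed.splits (Fp d m)).eval_eq_prod_roots_of_monic hmon]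
    rintro a ha rfl
    apply hz m hm
    rw [← Fp_eval]
    exact (mem_roots'.1 ha).2
  exact ⟨h.1.congr hae, by rw [← integral_congr_ae hae]; exact h.2⟩

lemma kap_int : Integrable (fun z => kap z * dens z) := by
  have h1 := dens_int.const_mul (Real.log 2)
  have h2 : Integrable (fun z : ℂ => log⁺ ‖z‖ * dens z) := by
    refine Integrable.mono' (log_dens_int 0).norm
      (((continuous_posLog.comp continuous_norm).mul dens_cont).aestronglyMeasurable) ?_
    refine Filter.Eventually.of_forall fun z => ?_
    rw [norm_mul, norm_mul, sub_zero]
    gcongr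
    rw [Real.norm_of_nonneg posLog_nonneg, Real.norm_eq_abs]
    exact max_le (abs_nonneg _) (le_abs_self _)
  refine (h1.add h2).congr (Filter.Eventually.of_forall fun z => ?_)
  simp [kap]
  ring

lemma gI_meas {d : ℕ} (gI : ℂ → ℝ)
    (hgI : ∀ lam : ℂ, Filter.Tendsto
      (fun k : ℕ => (1 / 2) * Real.log (1 + ‖(fc d lam)^[k] 0‖ ^ 2) / (d : ℝ) ^ (k - 1))
      Filter.atTop (nhds (gI lam))) : Measurable gI := by
  refine measurable_of_tendsto_metrizable (f := fun (k : ℕ) lam => (1 / 2) *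
    Real.log (1 + ‖(fc d lam)^[k] 0‖ ^ 2) / (d : ℝ) ^ (k - 1)) ?_ (tendsto_pi_nhds.2 hgI)
  intro k
  simp_rw [iter_eq]
  have := (cc_cont d k).measurable
  fun_prop

lemma gI_int {d : ℕ} (hd : 1 < d) (gI : ℂ → ℝ)
    (hgI : ∀ lam : ℂ, Filter.Tendsto
      (fun k : ℕ => (1 / 2) * Real.log (1 + ‖(fc d lam)^[k] 0‖ ^ 2) / (d : ℝ) ^ (k - 1))
      Filter.atTop (nhds (gI lam))) : Integrable (fun z => gI z * dens z) := by
  refine Integrable.mono' (kap_int.const_mul 2)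
    ((gI_meas gI hgI).mul dens_cont.measurable).aestronglyMeasurable ?_
  refine Filter.Eventually.of_forall fun z => ?_
  have h := gI_bound hd gI hgI z 1 le_rfl
  rw [cc_one hd] at h
  simp only [Nat.sub_self, pow_zero, one_mul] at h
  have hp : log⁺ ‖z‖ ≤ kap z := by
    unfold kap
    linarith [Real.log_nonneg (show (1 : ℝ) ≤ 2 by norm_num)]
  have hp0 : 0 ≤ log⁺ ‖z‖ := posLog_nonneg
  rw [norm_mul, Real.norm_of_nonneg (dens_nonneg z), ← mul_assoc]
  apply mul_le_mul_of_nonneg_right _ (dens_nonneg z)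
  rw [Real.norm_eq_abs]
  rw [abs_le] at h ⊢
  constructor <;> linarith [h.1, h.2, kap_nonneg z]

lemma E_bound {d : ℕ} (hd : 1 < d) (gI : ℂ → ℝ)
    (hgI : ∀ lam : ℂ, Filter.Tendsto
      (fun k : ℕ => (1 / 2) * Real.log (1 + ‖(fc d lam)^[k] 0‖ ^ 2) / (d : ℝ) ^ (k - 1))
      Filter.atTop (nhds (gI lam))) :
    ∃ C : ℝ, 0 < C ∧ ∀ m : ℕ, 1 ≤ m → ∀ φ : ℂ → ℝ, ∀ φinf : ℝ,
      ContDiff ℝ 2 φ →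
      ContDiffAt ℝ 2 (fun w : ℂ => if w = 0 then φinf else φ w⁻¹) 0 →
      ∀ K : ℝ, (∀ lam : ℂ, |(1 + ‖lam‖ ^ 2) ^ 2 * lap φ lam / 2| ≤ K) →
      |((d : ℝ) - 1) * (((Fp d m).roots.map φ).sum
          - (d : ℝ) ^ (m - 1) * (φinf + ∫ lam : ℂ, gI lam * lap φ lam / (2 * π)))|
        ≤ K * (2 * Real.log d * m + C) := by
  obtain ⟨C, hC, hlp⟩ := lp_int hd
  have hd1 : (1 : ℝ) < d := by exact_mod_cast hd
  have hd10 : 0 < (d : ℝ) - 1 := by linarith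
  have hkap0 : 0 ≤ ∫ z, kap z * dens z :=
    integral_nonneg fun z => mul_nonneg (kap_nonneg z) (dens_nonneg z)
  refine ⟨C + ((d : ℝ) - 1) * (∫ z, kap z * dens z) + 1, by positivity, ?_⟩
  intro m hm φ φinf hφ hχ K hK
  have hK0 : 0 ≤ K := (abs_nonneg _).trans (hK 0)
  obtain ⟨hF1, hF2⟩ := green_F hd hφ hχ hK hm
  have hg := lap_int hφ hK (gI_meas gI hgI).aestronglyMeasurable (gI_int hd gI hgI)
  have hπ := pi_pos
  have hE : ((d : ℝ) - 1) * (((Fp d m).roots.map φ).sum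
      - (d : ℝ) ^ (m - 1) * (φinf + ∫ lam : ℂ, gI lam * lap φ lam / (2 * π))) =
      ((d : ℝ) - 1) / (2 * π) * ∫ z, (Real.log ‖cc d z m‖ * lap φ z -
        (d : ℝ) ^ (m - 1) * (gI z * lap φ z)) := by
    rw [integral_sub hF1 (hg.const_mul _), hF2, integral_const_mul, integral_div]
    field_simp
    ring
  obtain ⟨hl1, hl2⟩ := hlp m hm
  have hmaj : |∫ z, (Real.log ‖cc d z m‖ * lap φ z - (d : ℝ) ^ (m - 1) * (gI z * lap φ z))| ≤
      ∫ z, 2 * π * K * (kap z * dens z + log⁺ (‖cc d z m‖⁻¹) * dens z) := by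
    rw [← Real.norm_eq_abs]
    apply norm_integral_le_of_norm_le ((kap_int.add hl1).const_mul (2 * π * K))
    refine Filter.Eventually.of_forall fun z => ?_
    have h1 := gI_bound hd gI hgI z m hm
    have h2 := log_cc d z m
    have h3 := lap_bd hK z
    have h4 : |Real.log ‖cc d z m‖ - (d : ℝ) ^ (m - 1) * gI z| ≤
        kap z + log⁺ (‖cc d z m‖⁻¹) := by
      have h5 : 0 ≤ log⁺ (‖cc d z m‖⁻¹) := posLog_nonneg
      rw [h2]
      rw [abs_le] at h1 ⊢
      constructor <;> linarith [h1.1, h1.2]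
    rw [Real.norm_eq_abs, show Real.log ‖cc d z m‖ * lap φ z -
      (d : ℝ) ^ (m - 1) * (gI z * lap φ z) =
      (Real.log ‖cc d z m‖ - (d : ℝ) ^ (m - 1) * gI z) * lap φ z by ring, abs_mul]
    have := mul_le_mul h4 h3 (abs_nonneg _) ((abs_nonneg _).trans h4)
    simp only [Pi.add_apply]
    linarith
  rw [integral_const_mul, integral_add kap_int hl1] at hmaj
  rw [hE, abs_mul, abs_of_pos (by positivity)]
  calc _ ≤ ((d : ℝ) - 1) / (2 * π) * (2 * π * K *
        ((∫ z, kap z * dens z) + ∫ z, log⁺ (‖cc d z m‖⁻¹) * dens z)) := by gcongr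
    _ = K * (((d : ℝ) - 1) * (∫ z, kap z * dens z) +
        ((d : ℝ) - 1) * ∫ z, log⁺ (‖cc d z m‖⁻¹) * dens z) := by field_simp
    _ ≤ _ := by
      refine mul_le_mul_of_nonneg_left ?_ hK0
      linarith

lemma roots_prod_sum {d : ℕ} (hd : 1 < d) (φ : ℂ → ℝ) (s : Finset ℕ) (hs : ∀ m ∈ s, 1 ≤ m) :
    (((∏ m ∈ s, Fp d m).roots).map φ).sum = ∑ m ∈ s, ((Fp d m).roots.map φ).sum := by
  induction s using Finset.induction_on with
  | empty => simp
  | insert a s ha ih =>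
    have h1 : Fp d a ≠ 0 := Fp_ne_zero hd (hs a (Finset.mem_insert_self a s))
    have h2 : ∏ m ∈ s, Fp d m ≠ 0 := Finset.prod_ne_zero_iff.2 fun m hm =>
      Fp_ne_zero hd (hs m (Finset.mem_insert_of_mem hm))
    rw [Finset.prod_insert ha, Finset.sum_insert ha, roots_mul (mul_ne_zero h1 h2),
      Multiset.map_add, Multiset.sum_add, ih fun m hm => hs m (Finset.mem_insert_of_mem hm)]

lemma mu_split (n : ℕ) (f : ℕ → ℝ) :
    ∑ m ∈ n.divisors, (ArithmeticFunction.moebius (n / m) : ℝ) * f m =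
    ∑ m ∈ n.divisors.filter (fun m => ArithmeticFunction.moebius (n / m) = 1), f m -
    ∑ m ∈ n.divisors.filter (fun m => ArithmeticFunction.moebius (n / m) = -1), f m := by
  rw [Finset.sum_filter, Finset.sum_filter, ← Finset.sum_sub_distrib]
  apply Finset.sum_congr rfl
  intro m _
  rcases ArithmeticFunction.moebius_eq_or (n / m) with h | h | h <;> rw [h] <;> norm_num

theorem statement18 (d : ℕ) (hd : 1 < d) (gI : ℂ → ℝ)
    (hgI : ∀ lam : ℂ, Filter.Tendsto
      (fun k : ℕ => (1 / 2) * Real.log (1 + ‖(fc d lam)^[k] 0‖ ^ 2) / (d : ℝ) ^ (k - 1))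
      Filter.atTop (nhds (gI lam))) :
    ∃ C : ℝ, 0 < C ∧ ∀ n : ℕ, 1 < n →
      ∀ Φ : Polynomial (Polynomial ℂ),
      (∀ lam z : ℂ,
        (∏ m ∈ n.divisors.filter fun m => ArithmeticFunction.moebius (n / m) = 1,
            ((fc d lam)^[m] z - z)) =
          (Φ.map (evalRingHom lam)).eval z *
            ∏ m ∈ n.divisors.filter fun m => ArithmeticFunction.moebius (n / m) = -1,
              ((fc d lam)^[m] z - z)) →
      (∀ lam : ℂ, (Φ.map (evalRingHom lam)).Monic) →
      (∀ lam : ℂ, ((Φ.map (evalRingHom lam)).natDegree : ℤ) = nu d n) →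
      ∀ φ : ℂ → ℝ, ∀ φinf : ℝ,
      ContDiff ℝ 2 φ →
      ContDiffAt ℝ 2 (fun w : ℂ => if w = 0 then φinf else φ w⁻¹) 0 →
      ∀ K : ℝ, (∀ lam : ℂ, |(1 + ‖lam‖ ^ 2) ^ 2 * lap φ lam / 2| ≤ K) →
      |((d : ℝ) - 1) * (((Φ.coeff 0).roots).map φ).sum
          - (nu d n : ℝ) * (((d : ℝ) - 1) / d *
              (φinf + ∫ lam : ℂ, gI lam * lap φ lam / (2 * π)))|
        ≤ K * ((2 * Real.log d) * (∑ m ∈ n.divisors, (m : ℝ)) + C * n.divisors.card) := by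
  obtain ⟨C, hC, hE⟩ := E_bound hd gI hgI
  refine ⟨C, hC, ?_⟩
  intro n hn Φ hΦ _ _ φ φinf hφ hχ K hK
  have hdpos : (0 : ℝ) < d := by positivity
  have hm1 : ∀ m ∈ n.divisors, 1 ≤ m := fun m hm => Nat.pos_of_mem_divisors hm
  have hpoly : ∏ m ∈ n.divisors.filter (fun m => ArithmeticFunction.moebius (n / m) = 1), Fp d m =
      Φ.coeff 0 *
      ∏ m ∈ n.divisors.filter (fun m => ArithmeticFunction.moebius (n / m) = -1), Fp d m := by
    apply Polynomial.funext
    intro lam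
    have h := hΦ lam 0
    simp only [sub_zero, iter_eq] at h
    rw [eval_mul, eval_prod, eval_prod]
    simp only [Fp_eval]
    rw [h, ← coeff_zero_eq_eval_zero, coeff_map, coe_evalRingHom]
  have hne : ∏ m ∈ n.divisors.filter (fun m => ArithmeticFunction.moebius (n / m) = 1),
      Fp d m ≠ 0 := Finset.prod_ne_zero_iff.2 fun m hm =>
        Fp_ne_zero hd (hm1 m (Finset.mem_of_mem_filter m hm))
  have hsum : (((Φ.coeff 0).roots).map φ).sum = ∑ m ∈ n.divisors,
      (ArithmeticFunction.moebius (n / m) : ℝ) * ((Fp d m).roots.map φ).sum := by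
    rw [mu_split, ← roots_prod_sum hd φ _ fun m hm => hm1 m (Finset.mem_of_mem_filter m hm),
      ← roots_prod_sum hd φ _ fun m hm => hm1 m (Finset.mem_of_mem_filter m hm), hpoly,
      roots_mul (hpoly ▸ hne), Multiset.map_add, Multiset.sum_add]
    ring
  have hnu : (nu d n : ℝ) = ∑ m ∈ n.divisors,
      (ArithmeticFunction.moebius (n / m) : ℝ) * (d * (d : ℝ) ^ (m - 1)) := by
    rw [nu]
    push_cast
    apply Finset.sum_congr rfl
    intro m hm
    rw [mul_pow_sub_one (by have := hm1 m hm; omega)]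
  have key : ((d : ℝ) - 1) * (((Φ.coeff 0).roots).map φ).sum
          - (nu d n : ℝ) * (((d : ℝ) - 1) / d *
              (φinf + ∫ lam : ℂ, gI lam * lap φ lam / (2 * π))) =
      ∑ m ∈ n.divisors, (ArithmeticFunction.moebius (n / m) : ℝ) *
        (((d : ℝ) - 1) * (((Fp d m).roots.map φ).sum
          - (d : ℝ) ^ (m - 1) * (φinf + ∫ lam : ℂ, gI lam * lap φ lam / (2 * π)))) := by
    rw [hsum, hnu, Finset.mul_sum, Finset.sum_mul, ← Finset.sum_sub_distrib]
    apply Finset.sum_congr rfl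
    intro m _
    field_simp
  rw [key]
  refine (Finset.abs_sum_le_sum_abs _ _).trans ?_
  calc _ ≤ ∑ m ∈ n.divisors, K * (2 * Real.log d * m + C) := by
        apply Finset.sum_le_sum
        intro m hm
        rw [abs_mul]
        have h1 : |(ArithmeticFunction.moebius (n / m) : ℝ)| ≤ 1 := by
          exact_mod_cast ArithmeticFunction.abs_moebius_le_one
        have h2 := hE m (hm1 m hm) φ φinf hφ hχ K hK
        exact (mul_le_of_le_one_left (abs_nonneg _) h1).trans h2
    _ = _ := by
        rw [← Finset.mul_sum, Finset.sum_add_distrib, ← Finset.mul_sum, Finset.sum_const,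
          nsmul_eq_mul]
        ring
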